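/- Let G be a stratified group with homogeneous distance d, let λ ∈ (0,1], and let Σ be a p-dimensional submanifold of G of class C^{1,λ}. Then, with ℓ = ℓ(p): dim_H Σ_c ≤ D(p) − λ if ℓ = 1; dim_H Σ_c ≤ D(p) − 1 if ℓ ≥ 2 and λ ≥ 1/(ℓ−1); and dim_H Σ_c ≤ D(p) − ℓλ/(1+λ) if ℓ ≥ 2 and λ ≤ 1/(ℓ−1), where dim_H is the Hausdorff dimension with respect to d. -/

import Mathlib

open Set Filter Function Module MeasureTheory
open scoped ENNReal Topology NNReal

noncomputable section

/-- A stratified (Carnot) group of step `ι`, identified with `ℝⁿ` through exponential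
coordinates of the first kind adapted to a graded basis.  The coordinate `i` has degree
`deg i` (the index of the layer it belongs to); coordinates are ordered by layer.
The group operation is smooth, has the origin as identity, `-x` as inverse of `x`
(exponential coordinates of the first kind), satisfies the Baker-Campbell-Hausdorff
grading structure, is compatible with the dilations
`δ_r x = (r^{deg i} * x i)_i`, and the layers are bracket generating:
`V_{j+1} = [V_1, V_j]`. -/
structure StratifiedGroup where
  n : ℕ
  ι : ℕ
  ι_pos : 0 < ι
  deg : Fin n → ℕ
  deg_pos : ∀ i, 1 ≤ deg i
  deg_le : ∀ i, deg i ≤ ι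
  deg_surj : ∀ j, 1 ≤ j → j ≤ ι → ∃ i, deg i = j
  deg_mono : Monotone deg
  mul : (Fin n → ℝ) → (Fin n → ℝ) → (Fin n → ℝ)
  mul_assoc' : ∀ x y z, mul (mul x y) z = mul x (mul y z)
  zero_mul' : ∀ x, mul 0 x = x
  mul_zero' : ∀ x, mul x 0 = x
  mul_neg' : ∀ x, mul x (-x) = 0
  mul_smooth : ContDiff ℝ (⊤ : ℕ∞) fun q : (Fin n → ℝ) × (Fin n → ℝ) => mul q.1 q.2
  mul_graded : ∀ x x' y y' : Fin n → ℝ, ∀ i : Fin n,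
    (∀ k, deg k < deg i → x k = x' k ∧ y k = y' k) →
    mul x y i - x i - y i = mul x' y' i - x' i - y' i
  dil_mul : ∀ r : ℝ, 0 < r → ∀ x y : Fin n → ℝ, ∀ i : Fin n,
    mul (fun k => r ^ deg k * x k) (fun k => r ^ deg k * y k) i = r ^ deg i * mul x y i
  bracket_gen : ∀ j, 1 ≤ j → j < ι → ∀ w : Fin n → ℝ,
    (∀ i, deg i ≠ j + 1 → w i = 0) →
    w ∈ Submodule.span ℝ { z : Fin n → ℝ | ∃ u v : Fin n → ℝ,
      (∀ i, deg i ≠ 1 → u i = 0) ∧ (∀ i, deg i ≠ j → v i = 0) ∧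
      z = fun i => if deg i = j + 1 then mul u v i - u i - v i else 0 }

namespace StratifiedGroup

/-- The underlying space of the group, `ℝⁿ` in graded coordinates. -/
abbrev Pt (G : StratifiedGroup) : Type := Fin G.n → ℝ

variable (G : StratifiedGroup)

/-- The intrinsic dilation `δ_r`. -/
def dil (r : ℝ) (x : G.Pt) : G.Pt := fun i => r ^ G.deg i * x i

/-- Left translation `l_x`. -/
def lTrans (x : G.Pt) : G.Pt → G.Pt := fun y => G.mul x y

/-- The left translate `x⁻¹ · S` of a set `S` (the inverse of `x` is `-x`). -/
def shift (x : G.Pt) (S : Set G.Pt) : Set G.Pt := (fun y => G.mul (-x) y) '' S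

/-- `n_j`: the dimension of the `j`-th layer. -/
def nLayer (j : ℕ) : ℕ := (Finset.univ.filter fun i : Fin G.n => G.deg i = j).card

/-- `m_j = n_1 + ⋯ + n_j`. -/
def mVal (j : ℕ) : ℕ := (Finset.univ.filter fun i : Fin G.n => G.deg i ≤ j).card

/-- Projection onto the `j`-th layer of coordinates. -/
def layerProj (j : ℕ) (x : G.Pt) : G.Pt := fun i => if G.deg i = j then x i else 0

/-- `D(p)`, the maximal dimension: the maximum of `d(α) = d_{α_1} + ⋯ + d_{α_p}` over
multi-indices `1 ≤ α_1 < ⋯ < α_p ≤ n`. -/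
def maxDim (p : ℕ) : ℕ :=
  sSup {D : ℕ | ∃ α : Finset (Fin G.n), α.card = p ∧ D = ∑ i ∈ α, G.deg i}

/-- `ℓ(p)`: the largest `l ∈ [1, ι]` with `p ≤ n_l + ⋯ + n_ι`. -/
def ellVal (p : ℕ) : ℕ :=
  sSup {l : ℕ | 1 ≤ l ∧ l ≤ G.ι ∧ p ≤ ∑ j ∈ Finset.Icc l G.ι, G.nLayer j}

/-- `r_p = p - (n_{ℓ(p)+1} + ⋯ + n_ι)`. -/
def rVal (p : ℕ) : ℕ := p - ∑ j ∈ Finset.Icc (G.ellVal p + 1) G.ι, G.nLayer j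

/-- The tangent space `T_0(x⁻¹ · S)` of the translated set at the identity:
the span of the tangent cone at `0` of `x⁻¹ · S`. -/
def tangentAt (S : Set G.Pt) (x : G.Pt) : Submodule ℝ G.Pt :=
  Submodule.span ℝ (tangentConeAt ℝ (G.shift x S) 0)

/-- The pointwise degree `d_Σ(x)` of a `p`-dimensional set `Σ = S` at `x`: the maximal
`d(α)` over multi-indices `α` such that the coefficient `c_α` of the tangent `p`-vector
is nonzero; equivalently, such that the projection of `T_0(x⁻¹·S)` onto the coordinates
in `α` is injective. -/
def pointDeg (p : ℕ) (S : Set G.Pt) (x : G.Pt) : ℕ :=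
  sSup {D : ℕ | ∃ α : Finset (Fin G.n), α.card = p ∧
    (∀ v ∈ G.tangentAt S x, (∀ i ∈ α, v i = 0) → v = 0) ∧ D = ∑ i ∈ α, G.deg i}

/-- The generalized characteristic set `Σ_c`: points of degree less than `D(p)`. -/
def charSet (p : ℕ) (S : Set G.Pt) : Set G.Pt := {x ∈ S | G.pointDeg p S x < G.maxDim p}

end StratifiedGroup

/-- A homogeneous distance on a stratified group: a continuous (for the Euclidean
topology) distance, left invariant and `1`-homogeneous with respect to dilations. -/
structure HomDistOn (G : StratifiedGroup) where
  d : G.Pt → G.Pt → ℝ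
  symm : ∀ x y, d x y = d y x
  triangle : ∀ x y z, d x z ≤ d x y + d y z
  eq_zero_iff : ∀ x y, d x y = 0 ↔ x = y
  continuous : Continuous fun q : G.Pt × G.Pt => d q.1 q.2
  left_invariant : ∀ x y z, d (G.mul z x) (G.mul z y) = d x y
  homogeneous : ∀ r : ℝ, 0 < r → ∀ x y, d (G.dil r x) (G.dil r y) = r * d x y

/-- The open ball of a homogeneous distance. -/
def HomDistOn.ball {G : StratifiedGroup} (D : HomDistOn G) (x : G.Pt) (r : ℝ) : Set G.Pt :=
  {y | D.d x y < r}

/-- Euclidean norm on `ℝⁿ` (the graded coordinates are orthonormal). -/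
def eNorm {n : ℕ} (x : Fin n → ℝ) : ℝ := Real.sqrt (∑ i, x i ^ 2)

/-- Euclidean scalar product. -/
def eDot {n : ℕ} (x y : Fin n → ℝ) : ℝ := ∑ i, x i * y i

/-- Euclidean distance. -/
def euclDist {n : ℕ} (x y : Fin n → ℝ) : ℝ := eNorm (x - y)

/-- Euclidean open ball `B_E(x, r)`. -/
def eBall {n : ℕ} (x : Fin n → ℝ) (r : ℝ) : Set (Fin n → ℝ) := {y | eNorm (y - x) < r}

/-- Diameter of a set with respect to a distance function. -/
def sdiam {α : Type*} (dist : α → α → ℝ) (A : Set α) : ℝ≥0∞ :=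
  ⨆ x ∈ A, ⨆ y ∈ A, ENNReal.ofReal (dist x y)

/-- The `q`-dimensional Hausdorff measure built from the distance `dist`. -/
def hMeas {α : Type*} (dist : α → α → ℝ) (q : ℝ) (A : Set α) : ℝ≥0∞ :=
  ⨆ (δ : ℝ≥0∞) (_ : 0 < δ),
    ⨅ (t : ℕ → Set α) (_ : A ⊆ ⋃ i, t i) (_ : ∀ i, sdiam dist (t i) ≤ δ),
      ∑' i, sdiam dist (t i) ^ q

/-- The Hausdorff dimension built from the distance `dist`:
`inf {q ≥ 0 : H^q(A) = 0}` (`∞` if there is no such exponent). -/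
def hDim {α : Type*} (dist : α → α → ℝ) (A : Set α) : ℝ≥0∞ :=
  sInf {q : ℝ≥0∞ | ∃ q' : ℝ, 0 ≤ q' ∧ q = ENNReal.ofReal q' ∧ hMeas dist q' A = 0}

/-- Hausdorff distance between two sets, with respect to a distance function. -/
def hdDist {α : Type*} (dist : α → α → ℝ) (A B : Set α) : ℝ≥0∞ :=
  max (⨆ a ∈ A, ⨅ b ∈ B, ENNReal.ofReal (dist a b))
      (⨆ b ∈ B, ⨅ a ∈ A, ENNReal.ofReal (dist a b))

/-- `(V, φ)` is a `C¹` chart (local parametrization) of the `p`-dimensional submanifold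
`S ⊆ ℝⁿ`: `φ` is a `C¹` injective immersion on the open set `V`, and it is an open map
onto (a relatively open piece of) `S`. -/
def IsC1Chart (n p : ℕ) (S : Set (Fin n → ℝ)) (V : Set (Fin p → ℝ))
    (φ : (Fin p → ℝ) → Fin n → ℝ) : Prop :=
  IsOpen V ∧ ContDiffOn ℝ 1 φ V ∧ Set.InjOn φ V ∧
  (∀ t ∈ V, Function.Injective (fderivWithin ℝ φ V t)) ∧
  (∀ W, W ⊆ V → IsOpen W → ∃ O : Set (Fin n → ℝ), IsOpen O ∧ φ '' W = S ∩ O)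

/-- `S ⊆ ℝⁿ` is a `p`-dimensional `C¹` submanifold. -/
def IsC1Submanifold (n p : ℕ) (S : Set (Fin n → ℝ)) : Prop :=
  ∀ x ∈ S, ∃ V φ, IsC1Chart n p S V φ ∧ x ∈ φ '' V

/-- A `C^{1,λ}` chart: a `C¹` chart whose differential is locally `λ`-Hölder continuous. -/
def IsHolderChart (n p : ℕ) (la : ℝ) (S : Set (Fin n → ℝ)) (V : Set (Fin p → ℝ))
    (φ : (Fin p → ℝ) → Fin n → ℝ) : Prop :=
  IsC1Chart n p S V φ ∧
  ∀ K : Set (Fin p → ℝ), IsCompact K → K ⊆ V → ∃ C : ℝ, ∀ s ∈ K, ∀ t ∈ K,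
    ‖fderivWithin ℝ φ V s - fderivWithin ℝ φ V t‖ ≤ C * ‖s - t‖ ^ la

/-- `S ⊆ ℝⁿ` is a `p`-dimensional submanifold of class `C^{1,λ}`. -/
def IsC1HolderSubmanifold (n p : ℕ) (la : ℝ) (S : Set (Fin n → ℝ)) : Prop :=
  ∀ x ∈ S, ∃ V φ, IsHolderChart n p la S V φ ∧ x ∈ φ '' V

/-- `S ⊆ ℝⁿ` is a `p`-dimensional Lipschitz submanifold: locally the graph of a
Euclidean Lipschitz map from a `p`-dimensional subspace to a complement. -/
def IsLipschitzSubmanifold (n p : ℕ) (S : Set (Fin n → ℝ)) : Prop :=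
  ∀ x ∈ S, ∃ (U : Set (Fin n → ℝ)) (W V' : Submodule ℝ (Fin n → ℝ))
    (f : W → (Fin n → ℝ)) (A : Set W),
    IsOpen U ∧ x ∈ U ∧ IsCompl W V' ∧ Module.finrank ℝ W = p ∧ IsOpen A ∧
    (∃ K : ℝ≥0, LipschitzWith K f) ∧ (∀ w, f w ∈ V') ∧
    S ∩ U = (fun w : W => (w : Fin n → ℝ) + f w) '' A

/-- The singular set `Σ_*` of a `p`-dimensional set: the points where the Euclidean
tangent cone is not a `p`-dimensional subspace. -/
def singularSet (n p : ℕ) (S : Set (Fin n → ℝ)) : Set (Fin n → ℝ) :=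
  {x ∈ S | ¬ ∃ T : Submodule ℝ (Fin n → ℝ), Module.finrank ℝ T = p ∧
    tangentConeAt ℝ S x = (T : Set (Fin n → ℝ))}

/-- The subspace of `ℝⁿ` of vectors supported on the coordinates in `s`. -/
def coordSubmodule (n : ℕ) (s : Set (Fin n)) : Submodule ℝ (Fin n → ℝ) where
  carrier := {v | ∀ i, i ∉ s → v i = 0}
  add_mem' := by
    intro a b ha hb i hi
    simp [Pi.add_apply, ha i hi, hb i hi]
  zero_mem' := by intro i _; rfl
  smul_mem' := by
    intro c a ha i hi
    simp [Pi.smul_apply, ha i hi]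

/-- The Plücker coordinates (with respect to the standard basis of `Λ_p ℝⁿ`) of the
`p`-vector `v_1 ∧ ⋯ ∧ v_p`: the coordinate indexed by the multi-index `α` (a subset of
cardinality `p`, enumerated increasingly) is the determinant of the corresponding minor. -/
def pluckerC {n p : ℕ} (v : Fin p → Fin n → ℝ) (α : Finset (Fin n)) : ℝ :=
  if h : α.card = p then
    Matrix.det (Matrix.of fun a b : Fin p => v b (α.orderIsoOfFin h a).1)
  else 0

/-- The projection `π_D` of degree `D` of a `p`-vector given in coordinates: it keeps
only the coefficients `c_α` with `d(α) = D`. -/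
def projDegC {n : ℕ} (deg : Fin n → ℕ) (D : ℕ) (c : Finset (Fin n) → ℝ) :
    Finset (Fin n) → ℝ :=
  fun α => if (∑ i ∈ α, deg i) = D then c α else 0

/-- The norm of a `p`-vector in coordinates (the standard basis of `Λ_p ℝⁿ` being
orthonormal for the graded metric). -/
def pvecNorm {n : ℕ} (c : Finset (Fin n) → ℝ) : ℝ :=
  Real.sqrt (∑ α : Finset (Fin n), (c α) ^ 2)

/-- Coefficients of the wedge product `u ∧ c` of a vector with a `p`-vector. -/
def wedgeVec {n : ℕ} (c : Finset (Fin n) → ℝ) (u : Fin n → ℝ) (β : Finset (Fin n)) : ℝ :=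
  ∑ i ∈ β, (-1 : ℝ) ^ (β.filter fun j => j < i).card * u i * c (β.erase i)

/-- The subspace associated with a simple `p`-vector `c`: vectors whose wedge with `c`
vanishes. -/
def pvecSpan {n : ℕ} (p : ℕ) (c : Finset (Fin n) → ℝ) : Set (Fin n → ℝ) :=
  {u | ∀ β : Finset (Fin n), β.card = p + 1 → wedgeVec c u β = 0}

/-- A Riemannian metric on `ℝⁿ`: a continuous family of inner products. -/
structure RiemannMetric (n : ℕ) where
  g : (Fin n → ℝ) → (Fin n → ℝ) → (Fin n → ℝ) → ℝ
  symm : ∀ x u v, g x u v = g x v u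
  lin : ∀ x v, IsLinearMap ℝ fun u => g x u v
  posdef : ∀ x u, u ≠ 0 → 0 < g x u u
  cont : Continuous fun q : (Fin n → ℝ) × (Fin n → ℝ) × (Fin n → ℝ) => g q.1 q.2.1 q.2.2

/-- The Gram determinant of the partial derivatives of a chart `φ` at `t`, with respect
to a Riemannian metric: the square of the Riemannian surface density. -/
def gramDet {n p : ℕ} (gt : RiemannMetric n) (φ : (Fin p → ℝ) → Fin n → ℝ)
    (V : Set (Fin p → ℝ)) (t : Fin p → ℝ) : ℝ :=
  Matrix.det (Matrix.of fun j k : Fin p =>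
    gt.g (φ t) (fderivWithin ℝ φ V t (Pi.single j 1)) (fderivWithin ℝ φ V t (Pi.single k 1)))

/-- The tangent `p`-tuple of a chart `φ` at `t₀`, left translated to the identity:
`(dl_{φ(t₀)⁻¹})(∂_{t_j} φ(t₀))`. -/
def tangentBasisT (G : StratifiedGroup) {p : ℕ} (V : Set (Fin p → ℝ))
    (φ : (Fin p → ℝ) → G.Pt) (t0 : Fin p → ℝ) : Fin p → G.Pt :=
  fun j => fderiv ℝ (G.lTrans (-(φ t0))) (φ t0) (fderivWithin ℝ φ V t0 (Pi.single j 1))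

/-- The density of the intrinsic measure in a chart:
`‖(∂_{t_1} φ ∧ ⋯ ∧ ∂_{t_p} φ)_{D, φ(t)}‖`. -/
def intIntegrand (G : StratifiedGroup) {p : ℕ} (D : ℕ) (V : Set (Fin p → ℝ))
    (φ : (Fin p → ℝ) → G.Pt) (t : Fin p → ℝ) : ℝ :=
  pvecNorm (projDegC G.deg D (pluckerC (tangentBasisT G V φ t)))

/-- Cumulative sums `μ_k = α_1 + ⋯ + α_k`. -/
def cumsum (α : ℕ → ℕ) (k : ℕ) : ℕ := ∑ l ∈ Finset.Icc 1 k, α l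

/-- The coefficient matrix `C` of the vectors `v_j` of `T_x Σ` with respect to the graded
basis `X_i` determined by the orthogonal layer-preserving matrix `U`:
`v_j = ∑_i C_{ij} X_i(x)`, i.e. `C_{ij} = ⟨U_{·i}, dl_{x⁻¹}(v_j)⟩`. -/
def Cmat (G : StratifiedGroup) {p : ℕ} (U : Matrix (Fin G.n) (Fin G.n) ℝ)
    (v : Fin p → G.Pt) (x : G.Pt) (i : Fin G.n) (j : Fin p) : ℝ :=
  ∑ k, U k i * fderiv ℝ (G.lTrans (-x)) x (v j) k

/-- The intrinsic integers `α_k(x)` attached to a point of a submanifold: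
`α_k = dim F_k - dim F_{k+1}` where `F_k` is the subspace of the (translated) tangent
space of vectors supported in the layers of degree `≥ k`. -/
def alphaOf (G : StratifiedGroup) (p : ℕ) (S : Set G.Pt) (x : G.Pt) (k : ℕ) : ℕ :=
  Module.finrank ℝ ↥(G.tangentAt S x ⊓ coordSubmodule G.n {i | k ≤ G.deg i}) -
  Module.finrank ℝ ↥(G.tangentAt S x ⊓ coordSubmodule G.n {i | k + 1 ≤ G.deg i})

/-- The part `Σ_{c,A}` of the generalized characteristic set. -/
def charSetA (G : StratifiedGroup) (p : ℕ) (S : Set G.Pt) : Set G.Pt :=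
  {x ∈ G.charSet p S | ∃ j, G.ellVal p + 1 ≤ j ∧ j ≤ G.ι ∧ alphaOf G p S x j < G.nLayer j}

/-- The part `Σ_{c,B}` of the generalized characteristic set. -/
def charSetB (G : StratifiedGroup) (p : ℕ) (S : Set G.Pt) : Set G.Pt :=
  {x ∈ G.charSet p S | (∀ j, G.ellVal p + 1 ≤ j → j ≤ G.ι → alphaOf G p S x j = G.nLayer j)
    ∧ alphaOf G p S x (G.ellVal p) < G.rVal p}

/-- The defining property of the threshold `r̄_ε`: for all `r < r̄_ε`, all `x ∈ S`, all
`y ∈ (x⁻¹·S) ∩ B_E(0,r)` and all unit vectors `w ⊥ T_0(x⁻¹·S)`, one has `|⟨y,w⟩| ≤ ε r`. -/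
def RbarSpec (G : StratifiedGroup) (S : Set G.Pt) (ε rb : ℝ) : Prop :=
  0 < rb ∧ ∀ r : ℝ, 0 < r → r < rb → ∀ x ∈ S, ∀ y ∈ G.shift x S ∩ eBall 0 r,
    ∀ w : G.Pt, eNorm w = 1 → (∀ v ∈ G.tangentAt S x, eDot v w = 0) → |eDot y w| ≤ ε * r

/-- `G` is (isomorphic to) the `n`-th Heisenberg group: step 2, horizontal layer of
dimension `2n`, one-dimensional center, nondegenerate bracket on the first layer. -/
def IsHeisenberg (G : StratifiedGroup) (n : ℕ) : Prop :=
  G.ι = 2 ∧ G.n = 2 * n + 1 ∧ G.nLayer 1 = 2 * n ∧ G.nLayer 2 = 1 ∧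
  ∀ u : G.Pt, (∀ i, G.deg i ≠ 1 → u i = 0) → u ≠ 0 →
    ∃ v : G.Pt, (∀ i, G.deg i ≠ 1 → v i = 0) ∧
      ∃ i, G.deg i = 2 ∧ G.mul u v i - u i - v i ≠ 0

end

/-- `A` admits countable covers of arbitrarily small `q`-dimensional size. -/
def HNull {α : Type*} (dist : α → α → ℝ) (q : ℝ) (A : Set α) : Prop :=
  ∀ ε : ℝ≥0∞, ε ≠ 0 → ∃ t : ℕ → Set α, A ⊆ ⋃ i, t i ∧ ∑' i, sdiam dist (t i) ^ q ≤ ε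

section HausdorffNull

variable {α : Type*} {dist : α → α → ℝ} {q : ℝ} {A B : Set α}

theorem HNull.hMeas_eq_zero (hq : 0 < q) (h : HNull dist q A) : hMeas dist q A = 0 := by
  unfold hMeas
  simp only [ENNReal.iSup_eq_zero]
  intro δ hδ
  refine le_antisymm (le_of_forall_gt fun ε hε => ?_) zero_le
  obtain ⟨ε', hε'0, hε'⟩ := exists_between hε
  have hδq : δ ^ q ≠ 0 := by
    simp [ENNReal.rpow_eq_zero_iff, hδ.ne', hq.le.not_gt]
  obtain ⟨t, htA, ht⟩ := h (min ε' (δ ^ q)) (by simp [hε'0.ne', hδq])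
  refine lt_of_le_of_lt ?_ hε'
  refine iInf_le_of_le t (iInf_le_of_le htA (iInf_le_of_le (fun i => ?_)
    (ht.trans (min_le_left _ _))))
  have h1 : sdiam dist (t i) ^ q ≤ δ ^ q :=
    ((ENNReal.le_tsum i).trans ht).trans (min_le_right _ _)
  exact (ENNReal.rpow_le_rpow_iff hq).1 h1

theorem HNull.mono (h : HNull dist q B) (hAB : A ⊆ B) : HNull dist q A := fun ε hε => by
  obtain ⟨t, ht, hs⟩ := h ε hε
  exact ⟨t, hAB.trans ht, hs⟩

theorem HNull.iUnion {A : ℕ → Set α} (h : ∀ i, HNull dist q (A i)) :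
    HNull dist q (⋃ i, A i) := by
  intro ε hε
  obtain ⟨ε', hε'0, hε'⟩ := ENNReal.exists_pos_sum_of_countable' hε ℕ
  choose t ht hs using fun i => h i (ε' i) (hε'0 i).ne'
  refine ⟨fun k => t (Nat.unpair k).1 (Nat.unpair k).2, ?_, ?_⟩
  · refine iUnion_subset fun i x hx => ?_
    obtain ⟨j, hj⟩ := mem_iUnion.1 (ht i hx)
    exact mem_iUnion.2 ⟨Nat.pair i j, by simpa using hj⟩
  · calc ∑' k, sdiam dist (t (Nat.unpair k).1 (Nat.unpair k).2) ^ q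
        = ∑' k : ℕ × ℕ, sdiam dist (t k.1 k.2) ^ q :=
          Nat.pairEquiv.symm.tsum_eq fun k : ℕ × ℕ => sdiam dist (t k.1 k.2) ^ q
      _ = ∑' i, ∑' j, sdiam dist (t i j) ^ q :=
          ENNReal.tsum_prod (f := fun i j => sdiam dist (t i j) ^ q)
      _ ≤ ∑' i, ε' i := ENNReal.tsum_le_tsum hs
      _ ≤ ε := hε'.le

theorem sdiam_empty : sdiam dist (∅ : Set α) = 0 := by simp [sdiam]

theorem HNull.of_finset_cover (hq : 0 < q) (hsymm : ∀ x y, dist x y = dist y x)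
    (htri : ∀ x y z, dist x z ≤ dist x y + dist y z)
    (h : ∀ ε : ℝ, 0 < ε → ∃ (F : Finset α) (r : ℝ), 0 < r ∧
      (∀ x ∈ A, ∃ z ∈ F, dist z x < r) ∧ F.card * (2 * r) ^ q ≤ ε) :
    HNull dist q A := by
  intro ε hε
  obtain ⟨ε', hε'0, hε'⟩ : ∃ ε' : ℝ, 0 < ε' ∧ ENNReal.ofReal ε' ≤ ε := by
    obtain ⟨e, he0, he⟩ := ENNReal.lt_iff_exists_nnreal_btwn.1 (pos_iff_ne_zero.2 hε)
    exact ⟨e, by exact_mod_cast he0, by simpa using he.le⟩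
  obtain ⟨F, r, hr, hF, hFr⟩ := h ε' hε'0
  have hball : ∀ z, sdiam dist {x | dist z x < r} ≤ ENNReal.ofReal (2 * r) := fun z => by
    refine iSup₂_le fun x hx => iSup₂_le fun y hy => ENNReal.ofReal_le_ofReal ?_
    have := htri x z y
    rw [hsymm x z] at this
    simp only [mem_ofPred_eq] at hx hy
    linarith
  refine ⟨fun i => if hi : i < F.card then {x | dist (F.equivFin.symm ⟨i, hi⟩ : α) x < r} else ∅,
    ?_, ?_⟩
  · intro x hx
    obtain ⟨z, hz, hzx⟩ := hF x hx
    refine mem_iUnion.2 ⟨F.equivFin ⟨z, hz⟩, ?_⟩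
    simpa using hzx
  · rw [tsum_eq_sum (s := Finset.range F.card)]
    · calc _ ≤ ∑ i ∈ Finset.range F.card, ENNReal.ofReal (2 * r) ^ q := by
            refine Finset.sum_le_sum fun i hi => ENNReal.rpow_le_rpow ?_ hq.le
            simp only [Finset.mem_range.1 hi, dif_pos]
            exact hball _
        _ = ENNReal.ofReal (F.card * (2 * r) ^ q) := by
            rw [Finset.sum_const, Finset.card_range, nsmul_eq_mul,
              ENNReal.ofReal_rpow_of_pos (by positivity), ENNReal.ofReal_mul (by positivity),
              ENNReal.ofReal_natCast]
        _ ≤ ENNReal.ofReal ε' := ENNReal.ofReal_le_ofReal hFr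
        _ ≤ ε := hε'
    · intro i hi
      rw [Finset.mem_range] at hi
      simp only [hi, dif_neg, not_false_eq_true, sdiam_empty, ENNReal.zero_rpow_of_pos hq]

theorem hDim_le_ofReal {c : ℝ} (h : ∀ q, 0 < q → c < q → HNull dist q A) :
    hDim dist A ≤ ENNReal.ofReal c := by
  refine ENNReal.le_of_forall_pos_le_add fun ε hε _ => ?_
  have hpos : 0 < max c 0 + (ε : ℝ) := add_pos_of_nonneg_of_pos (le_max_right _ _) hε
  have hlt : c < max c 0 + (ε : ℝ) := lt_add_of_le_of_pos (le_max_left _ _) hε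
  calc hDim dist A ≤ ENNReal.ofReal (max c 0 + ε) :=
        sInf_le ⟨_, hpos.le, rfl, (h _ hpos hlt).hMeas_eq_zero hpos⟩
    _ ≤ ENNReal.ofReal (max c 0) + ENNReal.ofReal ε := ENNReal.ofReal_add_le
    _ = ENNReal.ofReal c + ε := by simp

/-- If all separated finite subsets of `E` have bounded cardinality, a maximal one is a net. -/
theorem exists_net_of_card_separated_le {β : Type*} (ρ : β → β → ℝ)
    (hsymm : ∀ x y, ρ x y = ρ y x) {E : Set β} {r N : ℝ} (hr : 0 < r) (hself : ∀ x, ρ x x = 0)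
    (h : ∀ Z : Finset β, (Z : Set β) ⊆ E → (Z : Set β).Pairwise (fun x y => r ≤ ρ x y) →
      (Z.card : ℝ) ≤ N) :
    ∃ Z : Finset β, (Z.card : ℝ) ≤ N ∧ ∀ x ∈ E, ∃ z ∈ Z, ρ z x < r := by
  classical
  let P : ℕ → Prop := fun k => ∃ Z : Finset β, (Z : Set β) ⊆ E ∧
    (Z : Set β).Pairwise (fun x y => r ≤ ρ x y) ∧ Z.card = k
  have hP0 : P 0 := ⟨∅, by simp, by simp, by simp⟩
  have hPN : ∀ k, P k → k ≤ ⌊N⌋₊ := by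
    rintro k ⟨Z, hZ, hsep, rfl⟩
    exact Nat.le_floor (h Z hZ hsep)
  obtain ⟨Z, hZ, hsep, hcard⟩ := Nat.findGreatest_spec (P := P) (Nat.zero_le ⌊N⌋₊) hP0
  refine ⟨Z, h Z hZ hsep, fun x hx => ?_⟩
  by_contra! hcon
  have hxZ : x ∉ Z := fun hxZ => by
    have := hcon x hxZ
    rw [hself] at this
    linarith
  have hP : P (Z.card + 1) := by
    refine ⟨insert x Z, ?_, ?_, Finset.card_insert_of_notMem hxZ⟩
    · rw [Finset.coe_insert]
      exact insert_subset hx hZ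
    · rw [Finset.coe_insert]
      refine hsep.insert fun z hz _ => ⟨?_, hcon z hz⟩
      rw [hsymm]
      exact hcon z hz
  have := Nat.le_findGreatest (hPN _ hP) hP
  omega

end HausdorffNull

/-- Boundedly many cells of side `h` meet a cube of side `2R`. -/
theorem exists_finset_floor (k : ℕ) {R h : ℝ} (hh : 0 < h) (hhR : h ≤ R) :
    ∃ I : Finset (Fin k → ℤ), (I.card : ℝ) ≤ (5 * R / h) ^ k ∧
      ∀ a : Fin k → ℝ, (∀ j, |a j| ≤ R) → (fun j => ⌊a j / h⌋) ∈ I := by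
  have h1 : 1 ≤ R / h := (one_le_div hh).2 hhR
  refine ⟨Fintype.piFinset fun _ => Finset.Icc (-⌈R / h⌉) ⌈R / h⌉, ?_, fun a ha => ?_⟩
  · rw [Fintype.card_piFinset]
    simp only [Int.card_Icc, Finset.prod_const, Finset.card_univ, Fintype.card_fin, Nat.cast_pow]
    have h2 : (⌈R / h⌉ : ℝ) < R / h + 1 := Int.ceil_lt_add_one _
    have h3 : 0 ≤ ⌈R / h⌉ := Int.ceil_nonneg (by linarith)
    gcongr
    have h4 : (((⌈R / h⌉ + 1 - -⌈R / h⌉).toNat : ℤ) : ℝ) = 2 * ⌈R / h⌉ + 1 := by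
      rw [Int.toNat_of_nonneg (by omega)]
      push_cast
      ring
    rw [Int.cast_natCast] at h4
    rw [h4, mul_div_assoc]
    linarith
  · rw [Fintype.mem_piFinset]
    intro j
    have hj := abs_le.1 (ha j)
    rw [Finset.mem_Icc]
    constructor
    · rw [Int.le_floor]
      push_cast
      have : -(R / h) ≤ a j / h := by
        rw [← neg_div]
        gcongr
        exact hj.1
      linarith [Int.le_ceil (R / h)]
    · refine (Int.floor_le_floor (b := R / h) ?_).trans (Int.floor_le_ceil _)
      gcongr
      exact hj.2

theorem abs_sub_le_of_floor_div_eq {a b h : ℝ} (hh : 0 < h) (hab : ⌊a / h⌋ = ⌊b / h⌋) :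
    |a - b| ≤ h := by
  have h1 := (Int.abs_sub_lt_one_of_floor_eq_floor hab).le
  rwa [← sub_div, abs_div, abs_of_pos hh, div_le_one hh] at h1

theorem abs_sub_floor_div_mul_le {a h : ℝ} (hh : 0 < h) : |a - ⌊a / h⌋ * h| ≤ h := by
  have h1 := Int.floor_le (a / h)
  have h2 := (Int.lt_floor_add_one (a / h)).le
  rw [le_div_iff₀ hh] at h1
  rw [div_le_iff₀ hh] at h2
  rw [abs_le]
  constructor <;> linarith

/-- Restriction of vectors to the coordinates in `I`. -/
def coordRestrict {n : ℕ} (I : Finset (Fin n)) : (Fin n → ℝ) →ₗ[ℝ] (Fin n → ℝ) :=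
  LinearMap.pi fun i => if i ∈ I then LinearMap.proj i else 0

theorem coordRestrict_apply {n : ℕ} (I : Finset (Fin n)) (v : Fin n → ℝ) (i : Fin n) :
    coordRestrict I v i = if i ∈ I then v i else 0 := by
  simp only [coordRestrict, LinearMap.pi_apply]
  split_ifs <;> simp

/-- A subspace of dimension at most `k` is spanned by `k` vectors with entries at most one, with
coefficients controlled by the norm. -/
theorem exists_bounded_frame {n k : ℕ} (T : Submodule ℝ (Fin n → ℝ)) (hT : finrank ℝ T ≤ k) :
    ∃ u : Fin k → Fin n → ℝ, (∀ j i, |u j i| ≤ 1) ∧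
      ∀ v ∈ T, ∃ a : Fin k → ℝ, v = ∑ j, a j • u j ∧ ∀ j, |a j| ≤ n * ‖v‖ := by
  let e := (WithLp.linearEquiv 2 ℝ (Fin n → ℝ)).symm
  let T' : Submodule ℝ (EuclideanSpace ℝ (Fin n)) := T.map e.toLinearMap
  have hfin : finrank ℝ T' = finrank ℝ T := LinearEquiv.finrank_map_eq e T
  obtain ⟨l, rfl⟩ := Nat.exists_eq_add_of_le (hfin.trans_le hT)
  let b := stdOrthonormalBasis ℝ T'
  let w : Fin (finrank ℝ T') → Fin n → ℝ := fun j => e.symm (b j : EuclideanSpace ℝ (Fin n))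
  have hw : ∀ j i, |w j i| ≤ 1 := fun j i => by
    have h1 : ‖(b j : EuclideanSpace ℝ (Fin n))‖ = 1 := b.orthonormal.1 j
    have h2 := PiLp.norm_apply_le (b j : EuclideanSpace ℝ (Fin n)) i
    rw [h1] at h2
    exact h2
  refine ⟨Fin.append w 0, fun j i => ?_, fun v hv => ?_⟩
  · induction j using Fin.addCases with
    | left j => rw [Fin.append_left]; exact hw j i
    | right j => simp [Fin.append_right]
  · refine ⟨Fin.append (fun j => ∑ i, w j i * v i) 0, ?_, fun j => ?_⟩
    · rw [Fin.sum_univ_add]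
      simp only [Fin.append_left, Fin.append_right, Pi.zero_apply, smul_zero,
        Finset.sum_const_zero, add_zero]
      have hv' : e v ∈ T' := Submodule.mem_map_of_mem hv
      have h1 := congrArg (fun x : T' => e.symm (x : EuclideanSpace ℝ (Fin n)))
        (b.sum_repr' ⟨e v, hv'⟩)
      simp only [Submodule.coe_sum, Submodule.coe_smul, map_sum, map_smul,
        LinearEquiv.symm_apply_apply] at h1
      refine h1.symm.trans (Finset.sum_congr rfl fun j _ => ?_)
      congr 1
      rw [Submodule.coe_inner, PiLp.inner_apply]
      refine Finset.sum_congr rfl fun i _ => ?_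
      simp only [RCLike.inner_apply, conj_trivial]
      exact mul_comm _ _
    · induction j using Fin.addCases with
      | left j =>
        rw [Fin.append_left]
        calc |∑ i, w j i * v i| ≤ ∑ i, |w j i * v i| := Finset.abs_sum_le_sum_abs _ _
          _ ≤ ∑ _i : Fin n, ‖v‖ := by
            refine Finset.sum_le_sum fun i _ => ?_
            rw [abs_mul]
            exact (mul_le_mul (hw j i) (norm_le_pi_norm v i) (abs_nonneg _) zero_le_one).trans
              (one_mul _).le
          _ = n * ‖v‖ := by simp
      | right j => simp only [Fin.append_right, Pi.zero_apply, abs_zero]; positivity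

/-- Row rank equals column rank, for the rows with index in `I`. -/
theorem finrank_range_coordRestrict_comp {n p : ℕ} (I : Finset (Fin n))
    (A : (Fin p → ℝ) →ₗ[ℝ] (Fin n → ℝ)) :
    finrank ℝ (LinearMap.range (coordRestrict I ∘ₗ A)) =
      finrank ℝ (Submodule.span ℝ ((LinearMap.toMatrix' A).row '' I)) := by
  have h1 : finrank ℝ (LinearMap.range (coordRestrict I ∘ₗ A)) =
      (LinearMap.toMatrix' (coordRestrict I ∘ₗ A)).rank := by
    rw [Matrix.rank, ← Matrix.toLin'_apply', Matrix.toLin'_toMatrix']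
  rw [h1, Matrix.rank_eq_finrank_span_row]
  have hrow : ∀ i, (LinearMap.toMatrix' (coordRestrict I ∘ₗ A)).row i =
      if i ∈ I then (LinearMap.toMatrix' A).row i else 0 := fun i => by
    ext j
    simp only [Matrix.row, LinearMap.toMatrix'_apply, LinearMap.comp_apply, coordRestrict_apply]
    split_ifs <;> simp [LinearMap.toMatrix'_apply]
  refine congrArg (fun W : Submodule ℝ (Fin p → ℝ) => finrank ℝ W) (le_antisymm ?_ ?_)
  · rw [Submodule.span_le]
    rintro _ ⟨i, rfl⟩
    rw [SetLike.mem_coe, hrow]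
    split_ifs with hi
    · exact Submodule.subset_span ⟨i, hi, rfl⟩
    · exact Submodule.zero_mem _
  · refine Submodule.span_mono ?_
    rintro _ ⟨i, hi, rfl⟩
    refine ⟨i, ?_⟩
    rw [hrow, if_pos (by simpa using hi)]

/-- If the rows in `J` are independent and those in `I ⊇ J` have full rank, then some square
minor with rows between `J` and `I` is nonsingular. -/
theorem exists_injective_minor {n p : ℕ} {I J : Finset (Fin n)} (hJI : J ⊆ I)
    (A : (Fin p → ℝ) →ₗ[ℝ] (Fin n → ℝ))
    (hJ : J.card ≤ finrank ℝ (LinearMap.range (coordRestrict J ∘ₗ A)))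
    (hI : p ≤ finrank ℝ (LinearMap.range (coordRestrict I ∘ₗ A))) :
    ∃ α : Finset (Fin n), J ⊆ α ∧ α ⊆ I ∧ α.card = p ∧
      ∀ u, (∀ i ∈ α, A u i = 0) → u = 0 := by
  classical
  rw [finrank_range_coordRestrict_comp] at hJ hI
  set row := (LinearMap.toMatrix' A).row with hrow
  have hrange : row '' J = Set.range (fun i : J => row i) := image_eq_range _ _
  have hind : LinearIndepOn ℝ row (J : Set (Fin n)) := by
    have : LinearIndependent ℝ (fun i : J => row i) := by
      rw [linearIndependent_iff_card_eq_finrank_span]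
      refine le_antisymm ?_ (finrank_range_le_card _)
      rw [Fintype.card_coe, Set.finrank, ← hrange]
      exact hJ
    exact this
  obtain ⟨b, hbI, hJb, hspan, hb⟩ := exists_linearIndepOn_extension hind
    (Finset.coe_subset.2 hJI)
  have htop : Submodule.span ℝ (row '' b) = ⊤ := by
    rw [eq_top_iff]
    have h1 : Submodule.span ℝ (row '' I) = ⊤ := by
      apply Submodule.eq_top_of_finrank_eq
      refine le_antisymm (Submodule.finrank_le _) ?_
      simpa using hI
    rw [← h1]
    exact Submodule.span_le.2 hspan
  refine ⟨b.toFinset, ?_, ?_, ?_, fun u hu => ?_⟩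
  · intro i hi; simpa using hJb hi
  · intro i hi; exact hbI (by simpa using hi)
  · have h1 := finrank_span_eq_card (R := ℝ) (b := fun i : b => row i) hb
    rw [← image_eq_range, htop, finrank_top] at h1
    simp only [finrank_fintype_fun_eq_card, Fintype.card_fin] at h1
    rw [h1, Set.toFinset_card]
  · have hdot : ∀ w ∈ Submodule.span ℝ (row '' b), w ⬝ᵥ u = 0 := by
      intro w hw
      induction hw using Submodule.span_induction with
      | mem w hw =>
        obtain ⟨i, hi, rfl⟩ := hw
        have h2 := hu i (by simpa using hi)
        rw [← LinearMap.toMatrix'_mulVec] at h2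
        exact h2
      | zero => simp
      | add x y _ _ hx hy => simp [add_dotProduct, hx, hy]
      | smul c x _ hx => simp [smul_dotProduct, hx]
    rw [htop] at hdot
    exact dotProduct_self_eq_zero.1 (hdot u Submodule.mem_top)

namespace StratifiedGroup

variable (G : StratifiedGroup)

/-- The coordinates of degree at least `m`. -/
def coordsGE (m : ℕ) : Finset (Fin G.n) := Finset.univ.filter fun i => m ≤ G.deg i

theorem mem_coordsGE {m : ℕ} {i : Fin G.n} : i ∈ G.coordsGE m ↔ m ≤ G.deg i := by
  simp [coordsGE]

theorem coordsGE_succ_subset (m : ℕ) : G.coordsGE (m + 1) ⊆ G.coordsGE m := fun i => by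
  simp only [mem_coordsGE]; omega

theorem sum_nLayer_Icc (l : ℕ) : ∑ j ∈ Finset.Icc l G.ι, G.nLayer j = (G.coordsGE l).card := by
  rw [Finset.card_eq_sum_card_fiberwise (f := G.deg) (t := Finset.Icc l G.ι)]
  · refine Finset.sum_congr rfl fun j hj => ?_
    rw [nLayer, coordsGE, Finset.filter_filter]
    congr 1
    ext i
    simp only [Finset.mem_filter, Finset.mem_univ, true_and]
    have := (Finset.mem_Icc.1 hj).1
    omega
  · intro i hi
    simpa using ⟨G.mem_coordsGE.1 (by simpa using hi), G.deg_le i⟩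

variable {G} {p : ℕ}

theorem ellVal_mem (h : 1 ≤ G.ellVal p) :
    G.ellVal p ≤ G.ι ∧ p ≤ (G.coordsGE (G.ellVal p)).card := by
  have hne : {l : ℕ | 1 ≤ l ∧ l ≤ G.ι ∧ p ≤ ∑ j ∈ Finset.Icc l G.ι, G.nLayer j}.Nonempty := by
    by_contra hcon
    rw [not_nonempty_iff_eq_empty] at hcon
    rw [ellVal, hcon] at h
    simp at h
  have hmem := Nat.sSup_mem hne ⟨G.ι, fun l hl => hl.2.1⟩
  rw [← sum_nLayer_Icc]
  exact hmem.2

theorem card_coordsGE_ellVal_succ_le : (G.coordsGE (G.ellVal p + 1)).card ≤ p := by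
  by_contra! hcon
  have hι : G.ellVal p + 1 ≤ G.ι := by
    obtain ⟨i, hi⟩ := Finset.card_pos.1 (by omega : 0 < (G.coordsGE (G.ellVal p + 1)).card)
    exact (G.mem_coordsGE.1 hi).trans (G.deg_le i)
  have := le_csSup (s := {l : ℕ | 1 ≤ l ∧ l ≤ G.ι ∧ p ≤ ∑ j ∈ Finset.Icc l G.ι, G.nLayer j})
    ⟨G.ι, fun l hl => hl.2.1⟩ (a := G.ellVal p + 1)
    ⟨by omega, hι, by rw [sum_nLayer_Icc]; omega⟩
  rw [← ellVal] at this
  omega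

theorem sum_deg_eq_of_between {α : Finset (Fin G.n)} {l : ℕ} (h1 : G.coordsGE (l + 1) ⊆ α)
    (h2 : α ⊆ G.coordsGE l) (hα : α.card = p) :
    ((∑ i ∈ α, G.deg i : ℕ) : ℤ) =
      ∑ i ∈ G.coordsGE (l + 1), (G.deg i : ℤ) + l * (p - (G.coordsGE (l + 1)).card) := by
  rw [Nat.cast_sum, ← Finset.sum_sdiff h1, add_comm]
  congr 1
  rw [Finset.sum_congr rfl (g := fun _ => (l : ℤ)), Finset.sum_const, Finset.card_sdiff_of_subset h1,
    hα, nsmul_eq_mul, Nat.cast_sub, mul_comm]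
  · rw [← hα]; exact Finset.card_le_card h1
  · intro i hi
    rw [Finset.mem_sdiff, mem_coordsGE] at hi
    have := G.mem_coordsGE.1 (h2 hi.1)
    omega

theorem sum_deg_le (β : Finset (Fin G.n)) (hβ : β.card = p) (l : ℕ) :
    ((∑ i ∈ β, G.deg i : ℕ) : ℤ) ≤
      ∑ i ∈ G.coordsGE (l + 1), (G.deg i : ℤ) + l * (p - (G.coordsGE (l + 1)).card) := by
  have h1 : ∑ i ∈ β, ((G.deg i : ℤ) - l) ≤ ∑ i ∈ G.coordsGE (l + 1), ((G.deg i : ℤ) - l) := by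
    calc ∑ i ∈ β, ((G.deg i : ℤ) - l)
        ≤ ∑ i ∈ β, if i ∈ G.coordsGE (l + 1) then ((G.deg i : ℤ) - l) else 0 := by
          refine Finset.sum_le_sum fun i _ => ?_
          split_ifs with hi
          · rfl
          · rw [mem_coordsGE] at hi
            omega
      _ ≤ ∑ i, if i ∈ G.coordsGE (l + 1) then ((G.deg i : ℤ) - l) else 0 := by
          refine Finset.sum_le_sum_of_subset_of_nonneg (Finset.subset_univ _) fun i _ _ => ?_
          split_ifs with hi
          · rw [mem_coordsGE] at hi
            omega
          · rfl
      _ = _ := by rw [Finset.sum_ite_mem, Finset.univ_inter]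
  simp only [Finset.sum_sub_distrib, Finset.sum_const, nsmul_eq_mul, hβ] at h1
  rw [Nat.cast_sum]
  linarith

theorem bddAbove_sum_deg (P : Finset (Fin G.n) → Prop) :
    BddAbove {D : ℕ | ∃ α : Finset (Fin G.n), P α ∧ D = ∑ i ∈ α, G.deg i} :=
  ⟨∑ i, G.deg i, by
    rintro _ ⟨α, -, rfl⟩
    exact Finset.sum_le_sum_of_subset (Finset.subset_univ _)⟩

theorem maxDim_eq (h : 1 ≤ G.ellVal p) :
    (G.maxDim p : ℤ) = ∑ i ∈ G.coordsGE (G.ellVal p + 1), (G.deg i : ℤ) +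
      G.ellVal p * (p - (G.coordsGE (G.ellVal p + 1)).card) := by
  obtain ⟨α, h1, h2, hα⟩ := Finset.exists_subsuperset_card_eq
    (G.coordsGE_succ_subset (G.ellVal p)) card_coordsGE_ellVal_succ_le (ellVal_mem h).2
  have hmem : ∑ i ∈ α, G.deg i ∈
      {D : ℕ | ∃ α : Finset (Fin G.n), α.card = p ∧ D = ∑ i ∈ α, G.deg i} := ⟨α, hα, rfl⟩
  refine le_antisymm ?_ ?_
  · obtain ⟨β, hβ, hβD⟩ := Nat.sSup_mem ⟨_, hmem⟩ (bddAbove_sum_deg _)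
    rw [maxDim, hβD]
    exact sum_deg_le β hβ _
  · rw [← sum_deg_eq_of_between h1 h2 hα]
    exact_mod_cast le_csSup (bddAbove_sum_deg _) hmem

/-- A characteristic point fails one of the two rank conditions on the layers of degree greater
than `ℓ(p)` and at least `ℓ(p)`. -/
theorem rank_lt_of_mem_charSet {S : Set G.Pt} {x : G.Pt} (hx : x ∈ G.charSet p S)
    (h : 1 ≤ G.ellVal p) (A : (Fin p → ℝ) →ₗ[ℝ] G.Pt)
    (hA : G.tangentAt S x ≤ LinearMap.range A) :
    finrank ℝ (LinearMap.range (coordRestrict (G.coordsGE (G.ellVal p + 1)) ∘ₗ A)) <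
        (G.coordsGE (G.ellVal p + 1)).card ∨
      finrank ℝ (LinearMap.range (coordRestrict (G.coordsGE (G.ellVal p)) ∘ₗ A)) < p := by
  by_contra! hcon
  obtain ⟨α, h1, h2, hα, hinj⟩ := exists_injective_minor (G.coordsGE_succ_subset _) A hcon.1 hcon.2
  have hdeg := sum_deg_eq_of_between h1 h2 hα
  rw [← maxDim_eq h] at hdeg
  have hmem : ∑ i ∈ α, G.deg i ∈ {D : ℕ | ∃ α : Finset (Fin G.n), (α.card = p ∧
      ∀ v ∈ G.tangentAt S x, (∀ i ∈ α, v i = 0) → v = 0) ∧ D = ∑ i ∈ α, G.deg i} := by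
    refine ⟨α, ⟨hα, fun v hv hv0 => ?_⟩, rfl⟩
    obtain ⟨u, rfl⟩ := hA hv
    rw [hinj u hv0, map_zero]
  have hle := le_csSup (bddAbove_sum_deg _) hmem
  have hlt := hx.2
  simp only [pointDeg, ← and_assoc] at hlt
  have hcast : ∑ i ∈ α, G.deg i = G.maxDim p := by exact_mod_cast hdeg
  omega

end StratifiedGroup

section MeanValue

variable {E F : Type*} [NormedAddCommGroup E] [NormedSpace ℝ E]
  [NormedAddCommGroup F] [NormedSpace ℝ F]

theorem Convex.norm_sub_sub_le_of_holder_deriv {f : E → F} {f' : E → E →L[ℝ] F} {s : Set E}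
    (hs : Convex ℝ s) {C la : ℝ} (hC : 0 ≤ C) (hla : 0 ≤ la)
    (hf : ∀ x ∈ s, HasFDerivWithinAt f (f' x) s x)
    (hf' : ∀ x ∈ s, ∀ y ∈ s, ‖f' x - f' y‖ ≤ C * ‖x - y‖ ^ la) {x y : E} (hx : x ∈ s)
    (hy : y ∈ s) : ‖f y - f x - f' x (y - x)‖ ≤ C * ‖y - x‖ ^ la * ‖y - x‖ := by
  have hsub : segment ℝ x y ⊆ s := hs.segment_subset hx hy
  refine (convex_segment x y).norm_image_sub_le_of_norm_hasFDerivWithin_le' (f' := f')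
    (fun z hz => (hf z (hsub hz)).mono hsub) (fun z hz => ?_) (left_mem_segment ℝ x y)
    (right_mem_segment ℝ x y)
  refine (hf' z (hsub hz) x hx).trans ?_
  gcongr
  obtain ⟨a, b, ha, hb, hab, rfl⟩ := hz
  rw [show a • x + b • y - x = b • (y - x) by
    rw [← eq_sub_iff_add_eq] at hab; subst hab; module, norm_smul, Real.norm_of_nonneg hb]
  exact mul_le_of_le_one_left (norm_nonneg _) (by linarith)

variable [FiniteDimensional ℝ E]

theorem ContDiff.exists_norm_fderiv_sub_le {f : E → F} (hf : ContDiff ℝ 2 f) (R : ℝ) :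
    ∃ C, 0 ≤ C ∧ ∀ x ∈ Metric.closedBall (0 : E) R, ∀ y ∈ Metric.closedBall (0 : E) R,
      ‖fderiv ℝ f x - fderiv ℝ f y‖ ≤ C * ‖x - y‖ := by
  have h1 : ContDiff ℝ 1 (fderiv ℝ f) := hf.fderiv_right (by norm_num)
  obtain ⟨C, hC⟩ := (isCompact_closedBall (0 : E) R).exists_bound_of_continuousOn
    (h1.continuous_fderiv (by norm_num)).continuousOn
  refine ⟨max C 0, le_max_right _ _, fun x hx y hy => ?_⟩
  exact (convex_closedBall (0 : E) R).norm_image_sub_le_of_norm_fderiv_le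
    (fun z _ => h1.differentiable (by norm_num) z)
    (fun z hz => (hC z hz).trans (le_max_left _ _)) hy hx

theorem ContDiff.exists_taylor_bound {f : E → F} (hf : ContDiff ℝ 2 f) (R : ℝ) :
    ∃ C, 0 ≤ C ∧ ∀ x ∈ Metric.closedBall (0 : E) R, ∀ y ∈ Metric.closedBall (0 : E) R,
      ‖f y - f x - fderiv ℝ f x (y - x)‖ ≤ C * ‖y - x‖ ^ 2 := by
  obtain ⟨C, hC0, hC⟩ := hf.exists_norm_fderiv_sub_le R
  refine ⟨C, hC0, fun x hx y hy => ?_⟩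
  have := (convex_closedBall (0 : E) R).norm_sub_sub_le_of_holder_deriv (f := f)
    (f' := fderiv ℝ f) hC0 zero_le_one
    (fun z _ => (hf.differentiable (by norm_num) z).hasFDerivAt.hasFDerivWithinAt)
    (by simpa only [Real.rpow_one] using hC) hx hy
  rw [Real.rpow_one] at this
  linarith [this]

end MeanValue

namespace StratifiedGroup

variable (G : StratifiedGroup)

theorem neg_mul_self (x : G.Pt) : G.mul (-x) x = 0 := by
  simpa using G.mul_neg' (-x)

theorem neg_mul_cancel_left (x y : G.Pt) : G.mul (-x) (G.mul x y) = y := by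
  rw [← G.mul_assoc', neg_mul_self, G.zero_mul']

theorem mul_neg_cancel_left (x y : G.Pt) : G.mul x (G.mul (-x) y) = y := by
  rw [← G.mul_assoc', G.mul_neg', G.zero_mul']

theorem contDiff_mul : ContDiff ℝ 2 fun q : G.Pt × G.Pt => G.mul q.1 q.2 :=
  contDiff_infty.1 G.mul_smooth 2

theorem contDiff_lTrans (x : G.Pt) : ContDiff ℝ 2 (G.lTrans x) :=
  G.contDiff_mul.comp (contDiff_const.prodMk contDiff_id)

theorem differentiable_lTrans (x : G.Pt) : Differentiable ℝ (G.lTrans x) :=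
  (G.contDiff_lTrans x).differentiable (by norm_num)

theorem lTrans_neg_lTrans (x : G.Pt) : G.lTrans (-x) ∘ G.lTrans x = id :=
  funext (G.neg_mul_cancel_left x)

theorem injective_lTrans (x : G.Pt) : Injective (G.lTrans x) :=
  LeftInverse.injective (g := G.lTrans (-x)) (G.neg_mul_cancel_left x)

theorem injective_fderiv_lTrans (x y : G.Pt) : Injective (fderiv ℝ (G.lTrans x) y) := by
  have h := fderiv_comp y (G.differentiable_lTrans (-x) (G.lTrans x y))
    (G.differentiable_lTrans x y)
  rw [lTrans_neg_lTrans, fderiv_id] at h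
  refine LeftInverse.injective (g := fderiv ℝ (G.lTrans (-x)) (G.lTrans x y)) fun v => ?_
  simpa using (DFunLike.congr_fun h v).symm

theorem exists_mul_sub_bound (R : ℝ) (hR : 0 ≤ R) :
    ∃ C, 0 ≤ C ∧ ∀ y z : G.Pt, ‖y‖ ≤ R → ‖z‖ ≤ R →
      ‖G.mul y z - y - z‖ ≤ C * ‖y‖ * ‖z‖ := by
  set f : G.Pt × G.Pt → G.Pt := fun q => G.mul q.1 q.2 - q.1 - q.2 with hfdef
  have hf : ContDiff ℝ 2 f := (G.contDiff_mul.sub contDiff_fst).sub contDiff_snd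
  obtain ⟨C, hC0, hC⟩ := hf.exists_norm_fderiv_sub_le R
  refine ⟨C, hC0, fun y z hy hz => ?_⟩
  have hder : ∀ w v : G.Pt, HasFDerivAt (fun v => f (w, v))
      ((fderiv ℝ f (w, v)).comp (ContinuousLinearMap.inr ℝ G.Pt G.Pt)) v := fun w v =>
    (hf.differentiable (by norm_num) (w, v)).hasFDerivAt.comp v (hasFDerivAt_prodMk_right w v)
  have hzero : ∀ v : G.Pt,
      (fderiv ℝ f (0, v)).comp (ContinuousLinearMap.inr ℝ G.Pt G.Pt) = 0 := fun v => by
    refine (hder 0 v).unique ?_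
    have : (fun v => f (0, v)) = fun _ : G.Pt => (0 : G.Pt) := by
      funext v; simp [hfdef, G.zero_mul']
    rw [this]
    exact hasFDerivAt_const _ _
  have hmv := (convex_closedBall (0 : G.Pt) R).norm_image_sub_le_of_norm_hasFDerivWithin_le
    (f := fun v => f (y, v)) (C := C * ‖y‖) (x := 0) (y := z)
    (fun v _ => (hder y v).hasFDerivWithinAt) (fun v hv => ?_)
    (by simpa using hR) (by simpa using hz)
  · simpa [hfdef, G.mul_zero'] using hmv
  · have hv' : ‖v‖ ≤ R := by simpa using hv
    have h1 := hC (y, v) (by simp [Prod.norm_def, hy, hv']) (0, v)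
      (by simp [Prod.norm_def, hv'])
    rw [← sub_zero ((fderiv ℝ f (y, v)).comp _), ← hzero v, ← ContinuousLinearMap.sub_comp]
    refine (ContinuousLinearMap.opNorm_comp_le _ _).trans ?_
    refine (mul_le_of_le_one_right (norm_nonneg _)
      (ContinuousLinearMap.norm_inr_le_one ℝ G.Pt G.Pt)).trans (h1.trans_eq ?_)
    simp [Prod.norm_def]

end StratifiedGroup

namespace StratifiedGroup

variable (G : StratifiedGroup)

theorem fderiv_lTrans_apply_of_deg_le (u y v : G.Pt) (i : Fin G.n)
    (hv : ∀ k, G.deg k < G.deg i → v k = 0) : fderiv ℝ (G.lTrans u) y v i = v i := by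
  have h1 : HasDerivAt (fun t : ℝ => G.lTrans u (y + t • v) i) (fderiv ℝ (G.lTrans u) y v i) 0 := by
    have hy : HasFDerivAt (G.lTrans u) (fderiv ℝ (G.lTrans u) y) (y + (0 : ℝ) • v) := by
      simpa using (G.differentiable_lTrans u y).hasFDerivAt
    have hl : HasDerivAt (fun t : ℝ => y + t • v) v 0 := by
      simpa using ((hasDerivAt_id (0 : ℝ)).smul_const v).const_add y
    exact (hasDerivAt_pi.1 (hy.comp_hasDerivAt 0 hl)) i
  have h2 : (fun t : ℝ => G.lTrans u (y + t • v) i) = fun t => G.mul u y i + t * v i := by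
    funext t
    have := G.mul_graded u u (y + t • v) y i fun k hk => ⟨rfl, by simp [hv k hk]⟩
    simp only [Pi.add_apply, Pi.smul_apply, smul_eq_mul] at this
    simp only [lTrans]
    linarith
  rw [h2] at h1
  refine h1.unique ?_
  simpa using ((hasDerivAt_id (0 : ℝ)).mul_const (v i)).const_add (G.mul u y i)

theorem det_fderiv_lTrans (u y : G.Pt) : (fderiv ℝ (G.lTrans u) y).det = 1 := by
  rw [ContinuousLinearMap.det, ← LinearMap.det_toMatrix', Matrix.det_of_isLowerTriangular]
  · refine Finset.prod_eq_one fun i _ => ?_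
    rw [LinearMap.toMatrix'_apply]
    refine (G.fderiv_lTrans_apply_of_deg_le u y _ i fun k hk => ?_).trans ?_
    · exact Pi.single_eq_of_ne (by rintro rfl; exact lt_irrefl _ hk) _
    · simp
  · intro i j hij
    have hij' : i < j := hij
    rw [LinearMap.toMatrix'_apply]
    refine (G.fderiv_lTrans_apply_of_deg_le u y _ i fun k hk => ?_).trans ?_
    · exact Pi.single_eq_of_ne (by rintro rfl; exact absurd (G.deg_mono hij'.le) (not_le.2 hk)) _
    · exact Pi.single_eq_of_ne hij'.ne _

theorem volume_image_lTrans (u : G.Pt) {B : Set G.Pt} (hB : MeasurableSet B) :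
    volume (G.lTrans u '' B) = volume B := by
  rw [← lintegral_abs_det_fderiv_eq_addHaar_image volume hB
    (fun x _ => (G.differentiable_lTrans u x).hasFDerivAt.hasFDerivWithinAt)
    (G.injective_lTrans u).injOn]
  simp [det_fderiv_lTrans]

theorem image_lTrans_eq_preimage (u : G.Pt) (B : Set G.Pt) :
    G.lTrans u '' B = G.lTrans (-u) ⁻¹' B :=
  congrFun (image_eq_preimage_of_inverse (G.neg_mul_cancel_left u) (G.mul_neg_cancel_left u)) B

theorem measurableSet_image_lTrans (u : G.Pt) {B : Set G.Pt} (hB : MeasurableSet B) :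
    MeasurableSet (G.lTrans u '' B) := by
  rw [image_lTrans_eq_preimage]
  exact (G.differentiable_lTrans (-u)).continuous.measurable hB

/-- The open box whose `i`-th side is `2 η r ^ deg i`. -/
def box (η r : ℝ) : Set G.Pt := {z | ∀ i, |z i| < η * r ^ G.deg i}

theorem box_eq_pi (η r : ℝ) :
    G.box η r = Set.pi univ fun i => Ioo (-(η * r ^ G.deg i)) (η * r ^ G.deg i) := by
  ext z; simp [box, abs_lt]

theorem measurableSet_box (η r : ℝ) : MeasurableSet (G.box η r) := by
  rw [box_eq_pi]
  exact MeasurableSet.univ_pi fun i => measurableSet_Ioo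

theorem volume_box (η r : ℝ) :
    volume (G.box η r) = ∏ i, ENNReal.ofReal (2 * (η * r ^ G.deg i)) := by
  rw [box_eq_pi, volume_pi_pi]
  refine Finset.prod_congr rfl fun i _ => ?_
  rw [Real.volume_Ioo]; congr 1; ring

end StratifiedGroup

namespace HomDistOn

variable {G : StratifiedGroup} (D : HomDistOn G)

theorem exists_box_subset_ball :
    ∃ η : ℝ, 0 < η ∧ η ≤ 1 ∧ ∀ r : ℝ, 0 < r → ∀ z ∈ G.box η r, D.d 0 z < r / 2 := by
  have hcont : Continuous fun z : G.Pt => D.d 0 z := 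
    D.continuous.comp (continuous_const.prodMk continuous_id)
  have h0 : D.d 0 (0 : G.Pt) = 0 := (D.eq_zero_iff _ _).2 rfl
  have hev : ∀ᶠ z in 𝓝 (0 : G.Pt), D.d 0 z < 1 / 2 :=
    hcont.continuousAt.eventually_lt continuousAt_const (by rw [h0]; norm_num)
  obtain ⟨ε, hε, h⟩ := Metric.eventually_nhds_iff.1 hev
  refine ⟨min ε 1, by positivity, min_le_right _ _, fun r hr z hz => ?_⟩
  have hw : D.d 0 (G.dil r⁻¹ z) < 1 / 2 := by
    refine h (lt_of_lt_of_le ?_ (min_le_left ε 1))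
    rw [dist_zero_right, pi_norm_lt_iff (by positivity)]
    intro i
    rw [StratifiedGroup.dil, Real.norm_eq_abs, abs_mul, abs_of_pos (by positivity), inv_pow,
      inv_mul_lt_iff₀ (by positivity), mul_comm]
    exact hz i
  have hz' : G.dil r (G.dil r⁻¹ z) = z := by
    funext i
    simp only [StratifiedGroup.dil]
    rw [← mul_assoc, ← mul_pow, mul_inv_cancel₀ hr.ne', one_pow, one_mul]
  have h0' : G.dil r 0 = 0 := by funext i; simp [StratifiedGroup.dil]
  have := D.homogeneous r hr 0 (G.dil r⁻¹ z)
  rw [hz', h0'] at this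
  rw [this]
  nlinarith

/-- Left translates of a small box at points at mutual distance at least `r` are disjoint. -/
theorem disjoint_image_box {η r : ℝ} (h : ∀ z ∈ G.box η r, D.d 0 z < r / 2) {u v : G.Pt}
    (huv : r ≤ D.d u v) : Disjoint (G.lTrans u '' G.box η r) (G.lTrans v '' G.box η r) := by
  rw [Set.disjoint_left]
  rintro _ ⟨z, hz, rfl⟩ ⟨z', hz', hzz⟩
  have key : ∀ w y : G.Pt, D.d w (G.lTrans w y) = D.d 0 y := fun w y => by
    conv_lhs => rw [← G.mul_zero' w]
    rw [G.mul_zero']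
    have := D.left_invariant 0 y w
    rwa [G.mul_zero'] at this
  have h1 := D.triangle u (G.lTrans u z) v
  have h2 := key u z
  have h3 := key v z'
  rw [hzz] at h3
  rw [D.symm (G.lTrans u z) v] at h1
  linarith [h z hz, h z' hz']

end HomDistOn

namespace StratifiedGroup

variable (G : StratifiedGroup) {p : ℕ}

/-- The differential of a chart `φ` at `t`, left translated to the identity. -/
noncomputable def chartDeriv (V : Set (Fin p → ℝ)) (φ : (Fin p → ℝ) → G.Pt) (t : Fin p → ℝ) :
    (Fin p → ℝ) →L[ℝ] G.Pt :=
  (fderiv ℝ (G.lTrans (-(φ t))) (φ t)).comp (fderivWithin ℝ φ V t)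

variable {G} {S : Set G.Pt} {V : Set (Fin p → ℝ)} {φ : (Fin p → ℝ) → G.Pt}

theorem injective_chartDeriv (h : IsC1Chart G.n p S V φ) {t : Fin p → ℝ} (ht : t ∈ V) :
    Injective (G.chartDeriv V φ t) := by
  rw [chartDeriv, ContinuousLinearMap.coe_comp]
  exact (G.injective_fderiv_lTrans _ _).comp (h.2.2.2.1 t ht)

theorem hasFDerivAt_chart (h : IsC1Chart G.n p S V φ) {t : Fin p → ℝ} (ht : t ∈ V) :
    HasFDerivAt φ (fderivWithin ℝ φ V t) t :=
  ((h.2.1.differentiableOn (by norm_num) t ht).hasFDerivWithinAt).hasFDerivAt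
    (h.1.mem_nhds ht)

theorem hasFDerivAt_translated_chart (h : IsC1Chart G.n p S V φ) {t : Fin p → ℝ} (ht : t ∈ V) :
    HasFDerivAt (fun s => G.mul (-(φ t)) (φ s)) (G.chartDeriv V φ t) t :=
  (G.differentiable_lTrans (-(φ t)) (φ t)).hasFDerivAt.comp t (hasFDerivAt_chart h ht)

theorem exists_chart_estimate {la : ℝ} (hla : 0 < la) (hla1 : la ≤ 1)
    (h : IsHolderChart G.n p la S V φ) {K : Set (Fin p → ℝ)} (hK : IsCompact K)
    (hKc : Convex ℝ K) (hKV : K ⊆ V) (hKd : ∀ s ∈ K, ∀ t ∈ K, ‖s - t‖ ≤ 1) :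
    ∃ C, 0 ≤ C ∧ ∀ s ∈ K, ‖G.chartDeriv V φ s‖ ≤ C ∧ ∀ t ∈ K,
      ‖G.mul (-(φ s)) (φ t) - G.chartDeriv V φ s (t - s)‖ ≤ C * ‖t - s‖ ^ (1 + la) := by
  obtain ⟨C₀, hC₀⟩ := h.2 K hK hKV
  obtain ⟨hV, hφ, -⟩ := h.1
  obtain ⟨R, hR⟩ := hK.exists_bound_of_continuousOn (hφ.continuousOn.mono hKV)
  obtain ⟨M, hM⟩ := hK.exists_bound_of_continuousOn
    ((hφ.continuousOn_fderivWithin hV.uniqueDiffOn le_rfl).mono hKV)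
  set f : G.Pt × G.Pt → G.Pt := fun q => G.mul (-q.1) q.2 with hfdef
  have hf : ContDiff ℝ 2 f := G.contDiff_mul.comp (contDiff_fst.neg.prodMk contDiff_snd)
  obtain ⟨C₁, hC₁0, hC₁⟩ := hf.exists_taylor_bound R
  obtain ⟨C₂, hC₂⟩ := (isCompact_closedBall (0 : G.Pt × G.Pt) R).exists_bound_of_continuousOn
    (hf.continuous_fderiv (by norm_num)).continuousOn
  have hB : ∀ x y : G.Pt, HasFDerivAt (G.lTrans (-x))
      ((fderiv ℝ f (x, y)).comp (ContinuousLinearMap.inr ℝ G.Pt G.Pt)) y := fun x y =>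
    (hf.differentiable (by norm_num) (x, y)).hasFDerivAt.comp y (hasFDerivAt_prodMk_right x y)
  have hmem : ∀ s ∈ K, ∀ t ∈ K, (φ s, φ t) ∈ Metric.closedBall (0 : G.Pt × G.Pt) R :=
    fun s hs t ht => by simp [Prod.norm_def, hR s hs, hR t ht]
  have hfd : ∀ s ∈ K, ∀ v, fderiv ℝ (G.lTrans (-(φ s))) (φ s) v = fderiv ℝ f (φ s, φ s) (0, v) :=
    fun s _ v => by rw [(hB (φ s) (φ s)).fderiv]; simp
  have hBn : ∀ s ∈ K, ∀ v, ‖fderiv ℝ (G.lTrans (-(φ s))) (φ s) v‖ ≤ max C₂ 0 * ‖v‖ :=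
    fun s hs v => by
      rw [hfd s hs]
      refine (ContinuousLinearMap.le_opNorm _ _).trans ?_
      have h1 : ‖((0 : G.Pt), v)‖ = ‖v‖ := by simp [Prod.norm_def]
      rw [h1]
      gcongr
      exact (hC₂ _ (hmem s hs s hs)).trans (le_max_left _ _)
  have hder : ∀ s ∈ K, HasFDerivWithinAt φ (fderivWithin ℝ φ V s) K s := fun s hs =>
    (hasFDerivAt_chart h.1 (hKV hs)).hasFDerivWithinAt
  have hlip : ∀ s ∈ K, ∀ t ∈ K, ‖φ t - φ s‖ ≤ max M 0 * ‖t - s‖ := fun s hs t ht =>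
    hKc.norm_image_sub_le_of_norm_hasFDerivWithin_le hder
      (fun z hz => (hM z hz).trans (le_max_left _ _)) hs ht
  have hhol : ∀ s ∈ K, ∀ t ∈ K, ‖φ t - φ s - fderivWithin ℝ φ V s (t - s)‖ ≤
      max C₀ 0 * ‖t - s‖ ^ la * ‖t - s‖ := fun s hs t ht =>
    hKc.norm_sub_sub_le_of_holder_deriv (le_max_right _ _) hla.le hder
      (fun x hx y hy => (hC₀ x hx y hy).trans (by gcongr; exact le_max_left _ _)) hs ht
  refine ⟨max (max C₂ 0 * max M 0) (C₁ * max M 0 ^ 2 + max C₂ 0 * max C₀ 0),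
    le_max_of_le_left (by positivity), fun s hs => ⟨?_, fun t ht => ?_⟩⟩
  · refine ContinuousLinearMap.opNorm_le_bound _ (le_max_of_le_left (by positivity)) fun v => ?_
    refine (hBn s hs _).trans ?_
    refine le_trans ?_ (mul_le_mul_of_nonneg_right (le_max_left _ _) (norm_nonneg v))
    rw [mul_assoc]
    gcongr
    refine (ContinuousLinearMap.le_opNorm _ _).trans ?_
    gcongr
    exact (hM s hs).trans (le_max_left _ _)
  · have h1 := hC₁ _ (hmem s hs s hs) _ (hmem s hs t ht)
    have h2 : f (φ s, φ s) = 0 := G.neg_mul_self _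
    have h3 : ‖(φ s, φ t) - (φ s, φ s)‖ = ‖φ t - φ s‖ := by simp [Prod.norm_def]
    have h4 : (φ s, φ t) - (φ s, φ s) = (0, φ t - φ s) := by simp
    rw [h3, h4, h2, sub_zero, ← hfd s hs] at h1
    set B := fderiv ℝ (G.lTrans (-(φ s))) (φ s)
    have h5 := hBn s hs (φ t - φ s - fderivWithin ℝ φ V s (t - s))
    have h6 : G.mul (-(φ s)) (φ t) - G.chartDeriv V φ s (t - s) =
        (f (φ s, φ t) - B (φ t - φ s)) + B (φ t - φ s - fderivWithin ℝ φ V s (t - s)) := by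
      rw [map_sub B (φ t - φ s)]
      simp only [hfdef, chartDeriv, ContinuousLinearMap.comp_apply]
      abel
    have hpow : ‖t - s‖ ^ la * ‖t - s‖ = ‖t - s‖ ^ (1 + la) := by
      rw [Real.rpow_add_of_nonneg (norm_nonneg _) zero_le_one hla.le, Real.rpow_one, mul_comm]
    have hsq : ‖t - s‖ ^ 2 ≤ ‖t - s‖ ^ (1 + la) := by
      rw [← hpow, sq]
      gcongr
      exact Real.self_le_rpow_of_le_one (norm_nonneg _) (hKd t ht s hs) hla1
    rw [h6]
    refine (norm_add_le _ _).trans ?_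
    refine le_trans ?_ (mul_le_mul_of_nonneg_right (le_max_right _ _) (by positivity))
    rw [add_mul]
    refine add_le_add (h1.trans ?_) (h5.trans ?_)
    · calc C₁ * ‖φ t - φ s‖ ^ 2 ≤ C₁ * (max M 0 * ‖t - s‖) ^ 2 := by
            gcongr; exact hlip s hs t ht
        _ = C₁ * max M 0 ^ 2 * ‖t - s‖ ^ 2 := by ring
        _ ≤ _ := by gcongr
    · rw [mul_assoc, ← hpow, ← mul_assoc (max C₀ 0)]
      gcongr
      exact hhol s hs t ht

theorem tangentAt_le_range_chartDeriv (h : IsC1Chart G.n p S V φ) {t : Fin p → ℝ} (ht : t ∈ V) :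
    G.tangentAt S (φ t) ≤ LinearMap.range (G.chartDeriv V φ t : (Fin p → ℝ) →ₗ[ℝ] G.Pt) := by
  refine Submodule.span_le.2 fun y hy => ?_
  obtain ⟨α, l, hl, c, d, hd0, hd, hcd⟩ := exists_fun_of_mem_tangentConeAt hy
  set A := G.chartDeriv V φ t
  set τ : α → Fin p → ℝ := fun a => invFunOn φ V (G.mul (φ t) (d a)) with hτ
  have hcont : Tendsto (fun a => G.mul (φ t) (d a)) l (𝓝 (φ t)) := by
    have := ((G.differentiable_lTrans (φ t)).continuous.tendsto 0).comp hd0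
    rwa [lTrans, G.mul_zero'] at this
  have hS : ∀ᶠ a in l, G.mul (φ t) (d a) ∈ S := hd.mono fun a ha => by
    obtain ⟨z, hz, hz'⟩ := ha
    simp only [zero_add] at hz'
    rw [← hz', G.mul_neg_cancel_left]
    exact hz
  have key : ∀ W ⊆ V, IsOpen W → t ∈ W → ∀ᶠ a in l, τ a ∈ W ∧ φ (τ a) = G.mul (φ t) (d a) := by
    intro W hWV hW htW
    obtain ⟨O, hO, hWO⟩ := h.2.2.2.2 W hWV hW
    have hxO : φ t ∈ O := (hWO.subset (mem_image_of_mem φ htW)).2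
    filter_upwards [hS, hcont (hO.mem_nhds hxO)] with a ha ha'
    obtain ⟨w, hw, hwa⟩ := hWO.symm.subset ⟨ha, ha'⟩
    have : τ a = w := by
      simp only [hτ]
      rw [← hwa]
      exact h.2.2.1.leftInvOn_invFunOn (hWV hw)
    rw [this]
    exact ⟨hw, hwa⟩
  have hτt : Tendsto τ l (𝓝 t) := by
    refine tendsto_nhds.2 fun W hW htW => ?_
    exact (key (W ∩ V) inter_subset_right (hW.inter h.1) ⟨htW, ht⟩).mono fun a ha => ha.1.1
  have hder := hasFDerivAt_translated_chart h ht
  have hind : Topology.IsInducing A :=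
    (LinearMap.isClosedEmbedding_of_injective (f := (A : (Fin p → ℝ) →ₗ[ℝ] G.Pt))
      (LinearMap.ker_eq_bot.2 (injective_chartDeriv h ht))).isInducing
  have hlo := (hder.isLittleO.trans_isBigO (hder.isTheta_sub hind).2).comp_tendsto hτt
  have hψ : ∀ᶠ a in l, G.mul (-(φ t)) (φ (τ a)) = d a :=
    (key V subset_rfl h.1 ht).mono fun a ha => by rw [ha.2, G.neg_mul_cancel_left]
  have hlo' : (fun a => d a - A (τ a - t)) =o[l] d := by
    refine hlo.congr' (hψ.mono fun a ha => ?_) (hψ.mono fun a ha => ?_)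
    · simp only [comp_apply]
      rw [ha, G.neg_mul_self, sub_zero]
    · simp only [comp_apply]
      rw [ha, G.neg_mul_self, sub_zero]
  have hlo2 : (fun a => c a • (d a - A (τ a - t))) =o[l] fun a => c a • d a :=
    (Asymptotics.isBigO_refl c l).smul_isLittleO hlo'
  have hlim0 : Tendsto (fun a => c a • (d a - A (τ a - t))) l (𝓝 0) :=
    (Asymptotics.isLittleO_one_iff ℝ).1 (hlo2.trans_isBigO (hcd.isBigO_one ℝ))
  have hlim : Tendsto (fun a => A (c a • (τ a - t))) l (𝓝 y) := by
    have := hcd.sub hlim0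
    rw [sub_zero] at this
    refine this.congr fun a => ?_
    rw [map_smul, smul_sub, sub_sub_cancel]
  exact (Submodule.closed_of_finiteDimensional _).mem_of_tendsto hlim
    (Eventually.of_forall fun a => ⟨_, rfl⟩)

end StratifiedGroup

namespace StratifiedGroup

variable {G : StratifiedGroup}

/-- The side lengths, up to constants, of the boxes covering a separated set in a small piece of a
submanifold whose tangent space is degenerate in the coordinates of degree at least `m`. -/
noncomputable def boxSide (G : StratifiedGroup) (m : ℕ) (r e : ℝ) (i : Fin G.n) : ℝ :=
  if m ≤ G.deg i then e else r ^ G.deg i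

theorem prod_boxSide (m : ℕ) (r e : ℝ) :
    (∏ i, boxSide G m r e i) * r ^ (∑ i ∈ G.coordsGE m, G.deg i) =
      e ^ (G.coordsGE m).card * ∏ i, r ^ G.deg i := by
  rw [← Finset.prod_pow_eq_pow_sum, ← Finset.prod_const, coordsGE, Finset.prod_filter,
    Finset.prod_filter, ← Finset.prod_mul_distrib, ← Finset.prod_mul_distrib]
  refine Finset.prod_congr rfl fun i _ => ?_
  unfold boxSide
  split_ifs <;> ring

theorem exists_box_cover (m k : ℕ) {c : ℝ} (hc : 0 ≤ c) :
    ∃ C₃ : ℝ, 0 < C₃ ∧ ∀ (η r s e : ℝ) (T : Submodule ℝ G.Pt) (U : Set G.Pt), η ≤ 1 →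
      0 < r → r ≤ 1 → 0 < e → r ^ m ≤ e → e ≤ s → s ≤ r ^ (m - 1) → s * r ≤ e →
      finrank ℝ T ≤ k →
      (∀ u ∈ U, ‖u‖ ≤ c * s ∧ ∃ v ∈ T, ‖v‖ ≤ c * s ∧ ∀ i, m ≤ G.deg i → |u i - v i| ≤ c * e) →
      ∃ (J : Finset (Fin k → ℤ)) (w : (Fin k → ℤ) → G.Pt),
        (J.card : ℝ) ≤ (5 * ((G.n * c + 1) * s) / e) ^ k ∧
        (⋃ u ∈ U, G.lTrans u '' G.box η r) ⊆ ⋃ I ∈ J, Set.pi univ fun i =>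
          Icc (w I i - C₃ * boxSide G m r e i) (w I i + C₃ * boxSide G m r e i) := by
  obtain ⟨Cm, hCm0, hCm⟩ := G.exists_mul_sub_bound (max c 1) (by positivity)
  refine ⟨c + 1 + Cm * c + k, by positivity, fun η r s e T U hη hr hr1 he hme hes hsr hsre hT hU =>
    ?_⟩
  have hs : 0 < s := he.trans_le hes
  have hs1 : s ≤ 1 := hsr.trans (pow_le_one₀ hr.le hr1)
  obtain ⟨f, hf1, hf⟩ := exists_bounded_frame T hT
  have hR : s ≤ (G.n * c + 1) * s := by
    have : 0 ≤ G.n * c * s := by positivity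
    linarith
  obtain ⟨J, hJ, hJmem⟩ := exists_finset_floor k he (hes.trans hR)
  refine ⟨J, fun I i => if m ≤ G.deg i then ∑ j, I j * e * f j i else 0, hJ, ?_⟩
  refine iUnion₂_subset fun u hu => ?_
  rintro _ ⟨z, hz, rfl⟩
  obtain ⟨hus, v, hvT, hvs, huv⟩ := hU u hu
  obtain ⟨a, hva, ha⟩ := hf v hvT
  have haR : ∀ j, |a j| ≤ (G.n * c + 1) * s := fun j => by
    have h1 := (ha j).trans (mul_le_mul_of_nonneg_left hvs (Nat.cast_nonneg G.n))
    linarith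
  refine mem_iUnion₂.2 ⟨_, hJmem a haR, fun i _ => ?_⟩
  have hzi : ∀ i, |z i| ≤ r ^ G.deg i := fun i =>
    (hz i).le.trans (mul_le_of_le_one_left (by positivity) hη)
  have hzr : ‖z‖ ≤ r := (pi_norm_le_iff_of_nonneg hr.le).2 fun i =>
    (hzi i).trans (pow_le_of_le_one hr.le hr1 (by have := G.deg_pos i; omega))
  have hmul : |G.mul u z i - u i - z i| ≤ Cm * c * (s * r) := by
    refine (norm_le_pi_norm (G.mul u z - u - z) i).trans ?_
    refine (hCm u z ?_ ?_).trans ?_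
    · exact (hus.trans (mul_le_of_le_one_right hc hs1)).trans (le_max_left _ _)
    · exact (hzr.trans hr1).trans (le_max_right _ _)
    · calc Cm * ‖u‖ * ‖z‖ ≤ Cm * (c * s) * r := by gcongr
        _ = _ := by ring
  have hCmc : 0 ≤ Cm * c := by positivity
  rw [lTrans, mem_Icc]
  by_cases hi : m ≤ G.deg i
  · simp only [boxSide, if_pos hi]
    have h1 := huv i hi
    have h2 : |z i| ≤ e := (hzi i).trans ((pow_le_pow_of_le_one hr.le hr1 hi).trans hme)
    have h3 : Cm * c * (s * r) ≤ Cm * c * e := by gcongr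
    have h4 : |v i - ∑ j, (⌊a j / e⌋ : ℝ) * e * f j i| ≤ k * e := by
      have : v i - ∑ j, (⌊a j / e⌋ : ℝ) * e * f j i = ∑ j, (a j - ⌊a j / e⌋ * e) * f j i := by
        rw [hva]
        simp only [Finset.sum_apply, Pi.smul_apply, smul_eq_mul, sub_mul, Finset.sum_sub_distrib]
      rw [this]
      refine (Finset.abs_sum_le_sum_abs _ _).trans ?_
      refine (Finset.sum_le_card_nsmul _ _ e fun j _ => ?_).trans_eq (by simp)
      rw [abs_mul]
      exact (mul_le_of_le_one_right (abs_nonneg _) (hf1 j i)).trans (abs_sub_floor_div_mul_le he)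
    rw [abs_le] at hmul h1 h2 h4
    constructor <;> linarith
  · simp only [boxSide, if_neg hi]
    have hsd : s ≤ r ^ G.deg i :=
      hsr.trans (pow_le_pow_of_le_one hr.le hr1 (by omega))
    have h1 : |u i| ≤ c * r ^ G.deg i :=
      (norm_le_pi_norm u i).trans (hus.trans (by gcongr))
    have h2 := hzi i
    have h3 : Cm * c * (s * r) ≤ Cm * c * r ^ G.deg i := by
      gcongr
      exact (mul_le_of_le_one_right hs.le hr1).trans hsd
    have h4 : 0 ≤ k * r ^ G.deg i := by positivity
    rw [abs_le] at hmul h1 h2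
    constructor <;> linarith

end StratifiedGroup

namespace HomDistOn

variable {G : StratifiedGroup} (D : HomDistOn G)

open StratifiedGroup

theorem exists_card_separated_le (m k : ℕ) {c : ℝ} (hc : 0 ≤ c) :
    ∃ C : ℝ, 0 ≤ C ∧ ∀ (r s e : ℝ) (T : Submodule ℝ G.Pt) (U : Finset G.Pt),
      0 < r → r ≤ 1 → 0 < e → r ^ m ≤ e → e ≤ s → s ≤ r ^ (m - 1) → s * r ≤ e →
      finrank ℝ T ≤ k →
      (∀ u ∈ U, ‖u‖ ≤ c * s ∧ ∃ v ∈ T, ‖v‖ ≤ c * s ∧ ∀ i, m ≤ G.deg i → |u i - v i| ≤ c * e) →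
      ((U : Set G.Pt).Pairwise fun u u' => r ≤ D.d u u') →
      U.card * r ^ (∑ i ∈ G.coordsGE m, G.deg i) ≤
        C * ((s / e) ^ k * e ^ (G.coordsGE m).card) := by
  obtain ⟨η, hη0, hη1, hη⟩ := D.exists_box_subset_ball
  obtain ⟨C₃, hC₃, hcov⟩ := exists_box_cover (G := G) m k hc
  refine ⟨(5 * (G.n * c + 1)) ^ k * (C₃ / η) ^ G.n, by positivity,
    fun r s e T U hr hr1 he hme hes hsr hsre hT hU hsep => ?_⟩
  obtain ⟨J, w, hJ, hsub⟩ := hcov η r s e T U hη1 hr hr1 he hme hes hsr hsre hT hU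
  have hs : 0 < s := he.trans_le hes
  have hside : ∀ i, 0 ≤ boxSide G m r e i := fun i => by
    unfold boxSide; split_ifs <;> positivity
  have h1 : volume (⋃ u ∈ (U : Set G.Pt), G.lTrans u '' G.box η r) =
      U.card * volume (G.box η r) := by
    rw [show (⋃ u ∈ (U : Set G.Pt), G.lTrans u '' G.box η r) =
      ⋃ u ∈ U, G.lTrans u '' G.box η r from rfl, measure_biUnion_finset]
    · simp [G.volume_image_lTrans _ (G.measurableSet_box η r)]
    · exact fun u hu v hv huv => D.disjoint_image_box (hη r hr) (hsep hu hv huv)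
    · exact fun u _ => G.measurableSet_image_lTrans u (G.measurableSet_box η r)
  have h2 := (measure_mono hsub).trans (measure_biUnion_finset_le (μ := volume) J _)
  have h3 : ∀ I i, w I i + C₃ * boxSide G m r e i - (w I i - C₃ * boxSide G m r e i) =
      2 * C₃ * boxSide G m r e i := fun I i => by ring
  simp only [volume_pi_pi, Real.volume_Icc, h3, Finset.sum_const, nsmul_eq_mul] at h2
  rw [h1, volume_box, ← ENNReal.ofReal_prod_of_nonneg (fun i _ => by positivity),
    ← ENNReal.ofReal_prod_of_nonneg (fun i _ => by have := hside i; positivity),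
    ← ENNReal.ofReal_natCast, ← ENNReal.ofReal_natCast, ← ENNReal.ofReal_mul (by positivity),
    ← ENNReal.ofReal_mul (by positivity), ENNReal.ofReal_le_ofReal_iff
      (mul_nonneg (by positivity) (Finset.prod_nonneg fun i _ => by have := hside i; positivity))]
    at h2
  simp only [← mul_assoc, Finset.prod_mul_distrib, Finset.prod_const, Finset.card_univ,
    Fintype.card_fin] at h2
  have hP : 0 < ∏ i, r ^ G.deg i := Finset.prod_pos fun i _ => by positivity
  have hS : 0 ≤ ∏ i, boxSide G m r e i := Finset.prod_nonneg fun i _ => hside i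
  set P := ∏ i, r ^ G.deg i
  set B := ∏ i, boxSide G m r e i
  have h4 : (U.card : ℝ) * P ≤ J.card * ((C₃ / η) ^ G.n * B) := by
    have h2n : (0 : ℝ) < 2 ^ G.n := by positivity
    have hηn : 0 < η ^ G.n := by positivity
    rw [div_pow]
    have : (U.card : ℝ) * P * (2 ^ G.n * η ^ G.n) ≤
        J.card * (C₃ ^ G.n / η ^ G.n * B) * (2 ^ G.n * η ^ G.n) := by
      field_simp
      have := h2
      nlinarith
    exact le_of_mul_le_mul_right this (by positivity)
  have h5 := prod_boxSide (G := G) m r e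
  set Q := ∑ i ∈ G.coordsGE m, G.deg i
  set M := (G.coordsGE m).card
  have h6 : (U.card : ℝ) * r ^ Q * P ≤
      (5 * (G.n * c + 1)) ^ k * (C₃ / η) ^ G.n * ((s / e) ^ k * e ^ M) * P := by
    calc (U.card : ℝ) * r ^ Q * P = U.card * P * r ^ Q := by ring
      _ ≤ J.card * ((C₃ / η) ^ G.n * B) * r ^ Q := by gcongr
      _ = J.card * ((C₃ / η) ^ G.n * (B * r ^ Q)) := by ring
      _ = J.card * ((C₃ / η) ^ G.n * (e ^ M * P)) := by rw [h5]
      _ ≤ (5 * ((G.n * c + 1) * s) / e) ^ k * ((C₃ / η) ^ G.n * (e ^ M * P)) := by gcongr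
      _ = _ := by
        rw [show 5 * ((G.n * c + 1) * s) / e = 5 * (G.n * c + 1) * (s / e) by ring, mul_pow _ (s / e)]
        ring
  exact le_of_mul_le_mul_right h6 hP

end HomDistOn

namespace HomDistOn

variable {G : StratifiedGroup} (D : HomDistOn G) {p : ℕ} {S : Set G.Pt} {V : Set (Fin p → ℝ)}
  {φ : (Fin p → ℝ) → G.Pt} {la : ℝ}

open StratifiedGroup

theorem exists_card_separated_chart_le (hla : 0 < la) (hla1 : la ≤ 1)
    (h : IsHolderChart G.n p la S V φ) {K : Set (Fin p → ℝ)} (hK : IsCompact K)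
    (hKc : Convex ℝ K) (hKV : K ⊆ V) (hKd : ∀ s ∈ K, ∀ t ∈ K, ‖s - t‖ ≤ 1) (m k : ℕ) :
    ∃ C : ℝ, 0 ≤ C ∧ ∀ (r s e : ℝ) (Z : Finset (Fin p → ℝ)),
      0 < r → r ≤ 1 → 0 < e → r ^ m ≤ e → e ≤ s → s ≤ r ^ (m - 1) → s * r ≤ e →
      s ^ (1 + la) ≤ e → (Z : Set (Fin p → ℝ)) ⊆ K →
      (∀ t ∈ Z, finrank ℝ (LinearMap.range (coordRestrict (G.coordsGE m) ∘ₗ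
        (G.chartDeriv V φ t : (Fin p → ℝ) →ₗ[ℝ] G.Pt))) ≤ k) →
      ((Z : Set (Fin p → ℝ)).Pairwise fun t t' => r ≤ D.d (φ t) (φ t')) →
      Z.card * r ^ (∑ i ∈ G.coordsGE m, G.deg i) ≤
        C * (1 / s) ^ p * ((s / e) ^ k * e ^ (G.coordsGE m).card) := by
  classical
  obtain ⟨c, hc, hest⟩ := exists_chart_estimate hla hla1 h hK hKc hKV hKd
  obtain ⟨C, hC, hcell⟩ := D.exists_card_separated_le m k (c := 2 * c) (by positivity)
  obtain ⟨R, hR⟩ := hK.exists_bound_of_continuousOn (f := id) continuousOn_id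
  refine ⟨C * (5 * max R 1) ^ p, by positivity,
    fun r s e Z hr hr1 he hme hes hsr hsre hse hZK hrank hsep => ?_⟩
  have hs : 0 < s := he.trans_le hes
  have hs1 : s ≤ 1 := hsr.trans (pow_le_one₀ hr.le hr1)
  obtain ⟨J, hJ, hJmem⟩ := exists_finset_floor p (R := max R 1) hs (hs1.trans (le_max_right _ _))
  set Q := ∑ i ∈ G.coordsGE m, G.deg i
  set M := (G.coordsGE m).card
  have hrQ : 0 < r ^ Q := by positivity
  have hmaps : ∀ t ∈ Z, (fun j => ⌊t j / s⌋) ∈ J := fun t ht => hJmem t fun j =>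
    (norm_le_pi_norm t j).trans ((hR t (hZK ht)).trans (le_max_left _ _))
  have hfib : ∀ b ∈ J, (Z.filter fun t => (fun j => ⌊t j / s⌋) = b).card ≤
      ⌊C * ((s / e) ^ k * e ^ M) / r ^ Q⌋₊ := by
    intro b _
    refine Nat.le_floor ?_
    rw [le_div_iff₀ hrQ]
    rcases (Z.filter fun t => (fun j => ⌊t j / s⌋) = b).eq_empty_or_nonempty with h0 | ⟨t₀, ht₀⟩
    · rw [h0]; simp; positivity
    set Zb := Z.filter fun t => (fun j => ⌊t j / s⌋) = b with hZb
    have ht₀Z := (Finset.mem_filter.1 ht₀).1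
    obtain ⟨hA, hψ⟩ := hest t₀ (hZK ht₀Z)
    set A := G.chartDeriv V φ t₀
    set ψ : (Fin p → ℝ) → G.Pt := fun t => G.mul (-(φ t₀)) (φ t) with hψdef
    have hd : ∀ t t', D.d (ψ t) (ψ t') = D.d (φ t) (φ t') := fun t t' => D.left_invariant _ _ _
    have hinj : InjOn ψ (Zb : Set (Fin p → ℝ)) := fun t ht t' ht' heq => by
      by_contra hne
      have h1 := hsep (Finset.mem_filter.1 ht).1 (Finset.mem_filter.1 ht').1 hne
      simp only at h1
      rw [← hd, heq, (D.eq_zero_iff _ _).2 rfl] at h1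
      linarith
    rw [← Finset.card_image_of_injOn hinj]
    refine hcell r s e _ _ hr hr1 he hme hes hsr hsre (hrank t₀ ht₀Z) ?_ ?_
    · intro u hu
      obtain ⟨t, ht, rfl⟩ := Finset.mem_image.1 hu
      have hts : ‖t - t₀‖ ≤ s := (pi_norm_le_iff_of_nonneg hs.le).2 fun j =>
        abs_sub_le_of_floor_div_eq hs (congrFun ((Finset.mem_filter.1 ht).2.trans
          (Finset.mem_filter.1 ht₀).2.symm) j)
      have h1 := hψ t (hZK (Finset.mem_filter.1 ht).1)
      have h2 : ‖t - t₀‖ ^ (1 + la) ≤ s ^ (1 + la) := by gcongr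
      have h3 : ‖ψ t - A (t - t₀)‖ ≤ c * e := h1.trans (by gcongr; exact h2.trans hse)
      have h4 : ‖A (t - t₀)‖ ≤ c * s := (A.le_opNorm _).trans (by gcongr)
      have h5 : c * e ≤ c * s := by gcongr
      refine ⟨?_, coordRestrict (G.coordsGE m) (A (t - t₀)), ⟨t - t₀, rfl⟩, ?_, fun i hi => ?_⟩
      · have := norm_add_le (ψ t - A (t - t₀)) (A (t - t₀))
        rw [sub_add_cancel] at this
        linarith
      · have h6 : 0 ≤ c * s := by positivity
        refine (pi_norm_le_iff_of_nonneg (by positivity)).2 fun i => ?_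
        rw [coordRestrict_apply]
        split_ifs
        · have := norm_le_pi_norm (A (t - t₀)) i
          linarith
        · rw [norm_zero]; linarith
      · rw [coordRestrict_apply, if_pos (G.mem_coordsGE.2 hi)]
        have h6 := norm_le_pi_norm (ψ t - A (t - t₀)) i
        rw [Pi.sub_apply, Real.norm_eq_abs] at h6
        have h7 : 0 ≤ c * e := by positivity
        linarith
    · intro u hu u' hu' hne
      obtain ⟨t, ht, rfl⟩ := Finset.mem_image.1 (Finset.mem_coe.1 hu)
      obtain ⟨t', ht', rfl⟩ := Finset.mem_image.1 (Finset.mem_coe.1 hu')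
      simp only [hd]
      exact hsep (Finset.mem_filter.1 ht).1 (Finset.mem_filter.1 ht').1 fun he => hne (by rw [he])
  have hcard := Finset.card_le_mul_card_image_of_maps_to hmaps _ hfib
  have hcard' : (Z.card : ℝ) ≤ C * ((s / e) ^ k * e ^ M) / r ^ Q * (5 * max R 1 / s) ^ p := by
    calc (Z.card : ℝ) ≤ (⌊C * ((s / e) ^ k * e ^ M) / r ^ Q⌋₊ : ℝ) * J.card := by
          exact_mod_cast hcard
      _ ≤ _ := by
        gcongr
        exact Nat.floor_le (by positivity)
  calc (Z.card : ℝ) * r ^ Q ≤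
        C * ((s / e) ^ k * e ^ M) / r ^ Q * (5 * max R 1 / s) ^ p * r ^ Q := by gcongr
    _ = C * ((s / e) ^ k * e ^ M) * (5 * max R 1 / s) ^ p := by field_simp
    _ = _ := by
      rw [show 5 * max R 1 / s = 5 * max R 1 * (1 / s) by ring, mul_pow _ (1 / s)]; ring

theorem hNull_image_chart (hla : 0 < la) (hla1 : la ≤ 1)
    (h : IsHolderChart G.n p la S V φ) {K : Set (Fin p → ℝ)} (hK : IsCompact K)
    (hKc : Convex ℝ K) (hKV : K ⊆ V) (hKd : ∀ s ∈ K, ∀ t ∈ K, ‖s - t‖ ≤ 1)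
    {E : Set (Fin p → ℝ)} (hEK : E ⊆ K) {m k : ℕ} (hm : 1 ≤ m) {a b q : ℝ}
    (hma : (m : ℝ) - 1 ≤ a) (hab : a ≤ b) (hbm : b ≤ m) (hba : b ≤ a * (1 + la))
    (hE : ∀ t ∈ E, finrank ℝ (LinearMap.range (coordRestrict (G.coordsGE m) ∘ₗ
      (G.chartDeriv V φ t : (Fin p → ℝ) →ₗ[ℝ] G.Pt))) ≤ k)
    (hq : 0 < q)
    (hq' : ((∑ i ∈ G.coordsGE m, G.deg i : ℕ) : ℝ) + a * (p - k) -
      b * ((G.coordsGE m).card - k) < q) :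
    HNull D.d q (φ '' E) := by
  classical
  obtain ⟨C, hC, hcard⟩ := D.exists_card_separated_chart_le hla hla1 h hK hKc hKV hKd m k
  set Q := ∑ i ∈ G.coordsGE m, G.deg i
  set M := (G.coordsGE m).card
  set θ : ℝ := Q + a * (p - k) - b * (M - k) with hθ
  refine HNull.of_finset_cover hq D.symm D.triangle fun ε hε => ?_
  have hlim : Tendsto (fun r : ℝ => C * 2 ^ q * r ^ (q - θ)) (𝓝[>] 0) (𝓝 0) := by
    have h1 : Tendsto (fun r : ℝ => r ^ (q - θ)) (𝓝[>] 0) (𝓝 0) := by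
      have := (Real.continuousAt_rpow_const 0 (q - θ) (Or.inr (by linarith))).tendsto
      rw [Real.zero_rpow (by linarith)] at this
      exact this.mono_left nhdsWithin_le_nhds
    simpa using h1.const_mul (C * 2 ^ q)
  obtain ⟨r, hrε, hr, hr1⟩ := ((hlim.eventually_le_const hε).and
    (Ioc_mem_nhdsGT (zero_lt_one (α := ℝ)))).exists
  have ha : 0 ≤ a := by
    have : (1 : ℝ) ≤ m := by exact_mod_cast hm
    linarith
  have hnet := exists_net_of_card_separated_le (fun t t' => D.d (φ t) (φ t'))
    (fun t t' => D.symm _ _) (E := E) (N := C * r ^ (-θ)) hr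
    (fun t => (D.eq_zero_iff _ _).2 rfl) fun Z hZE hZ => ?_
  · obtain ⟨Z, hZ, hZE⟩ := hnet
    refine ⟨Z.image φ, r, hr, ?_, ?_⟩
    · rintro _ ⟨t, ht, rfl⟩
      obtain ⟨z, hz, hzt⟩ := hZE t ht
      exact ⟨φ z, Finset.mem_image_of_mem _ hz, hzt⟩
    · refine le_trans ?_ hrε
      calc ((Z.image φ).card : ℝ) * (2 * r) ^ q ≤ C * r ^ (-θ) * (2 * r) ^ q := by
            gcongr
            exact le_trans (by exact_mod_cast Finset.card_image_le) hZ
        _ = C * 2 ^ q * r ^ (q - θ) := by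
            rw [Real.mul_rpow (by norm_num) hr.le, sub_eq_neg_add, Real.rpow_add hr]; ring
  · have hpow : ∀ (x : ℝ) (N : ℕ), (r ^ x) ^ N = r ^ (x * N) := fun x N => by
      rw [Real.rpow_mul hr.le, Real.rpow_natCast]
    have hmono : ∀ {x y : ℝ}, x ≤ y → r ^ y ≤ r ^ x := fun hxy =>
      Real.rpow_le_rpow_of_exponent_ge hr hr1 hxy
    have key := hcard r (r ^ a) (r ^ b) Z hr hr1 (by positivity)
      (by rw [← Real.rpow_natCast]; exact hmono hbm) (hmono hab)
      (by rw [← Real.rpow_natCast, Nat.cast_sub hm, Nat.cast_one]; exact hmono hma)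
      (by rw [← Real.rpow_add_one hr.ne']; exact hmono (by linarith))
      (by rw [← Real.rpow_mul hr.le]; exact hmono hba)
      (hZE.trans hEK) (fun t ht => hE t (hZE ht)) hZ
    have hrQ : (0 : ℝ) < r ^ Q := by positivity
    rw [← Real.rpow_sub hr, one_div, ← Real.rpow_neg hr.le, hpow, hpow, hpow, mul_assoc,
      ← Real.rpow_add hr, ← Real.rpow_add hr] at key
    refine le_of_mul_le_mul_right (key.trans_eq ?_) hrQ
    rw [mul_assoc, ← Real.rpow_natCast r Q, ← Real.rpow_add hr]
    congr 2
    rw [hθ]; ring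

end HomDistOn

section HNull

variable {α : Type*} {dist : α → α → ℝ} {q : ℝ}

theorem HNull.empty (hq : 0 < q) : HNull dist q ∅ := fun ε _ =>
  ⟨fun _ => ∅, empty_subset _, by simp [sdiam_empty, hq]⟩

theorem HNull.union {A B : Set α} (hA : HNull dist q A) (hB : HNull dist q B) :
    HNull dist q (A ∪ B) := by
  refine (HNull.iUnion (A := fun i : ℕ => if i = 0 then A else B) fun i => ?_).mono ?_
  · split_ifs
    exacts [hA, hB]
  · exact union_subset (subset_iUnion_of_subset 0 (by simp)) (subset_iUnion_of_subset 1 (by simp))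

end HNull

namespace HomDistOn

variable {G : StratifiedGroup} (D : HomDistOn G) {p : ℕ} {S : Set G.Pt} {V : Set (Fin p → ℝ)}
  {φ : (Fin p → ℝ) → G.Pt} {la q : ℝ}

open StratifiedGroup

theorem exists_isOpen_hNull_charSet_inter (hla : 0 < la) (hla1 : la ≤ 1)
    (h : IsHolderChart G.n p la S V φ) {t : Fin p → ℝ} (ht : t ∈ V) (hl : 1 ≤ G.ellVal p)
    (hq : 0 < q) (hq1 : (G.maxDim p : ℝ) - min 1 (G.ellVal p * la) < q)
    (hq2 : 2 ≤ G.ellVal p → (G.maxDim p : ℝ) - min 1 (G.ellVal p * la / (1 + la)) < q) :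
    ∃ O, IsOpen O ∧ φ t ∈ O ∧ HNull D.d q (G.charSet p S ∩ O) := by
  obtain ⟨ρ₀, hρ₀, hρV⟩ := Metric.nhds_basis_closedBall.mem_iff.1 (h.1.1.mem_nhds ht)
  set ρ := min ρ₀ (1 / 2)
  have hρ : 0 < ρ := lt_min hρ₀ (by norm_num)
  set K := Metric.closedBall t ρ
  have hKV : K ⊆ V := (Metric.closedBall_subset_closedBall (min_le_left _ _)).trans hρV
  have hKd : ∀ s ∈ K, ∀ s' ∈ K, ‖s - s'‖ ≤ 1 := fun s hs s' hs' => by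
    rw [← dist_eq_norm]
    have h1 := dist_triangle_right s s' t
    have h2 : ρ ≤ 1 / 2 := min_le_right _ _
    linarith [Metric.mem_closedBall.1 hs, Metric.mem_closedBall.1 hs']
  obtain ⟨O, hO, hWO⟩ := h.1.2.2.2.2 (Metric.ball t ρ) (Metric.ball_subset_closedBall.trans hKV)
    Metric.isOpen_ball
  refine ⟨O, hO, (hWO.subset (mem_image_of_mem φ (Metric.mem_ball_self hρ))).2, ?_⟩
  set l := G.ellVal p with hldef
  set rk : ℕ → (Fin p → ℝ) → ℕ := fun m s => finrank ℝ (LinearMap.range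
    (coordRestrict (G.coordsGE m) ∘ₗ (G.chartDeriv V φ s : (Fin p → ℝ) →ₗ[ℝ] G.Pt))) with hrk
  set N := (G.coordsGE (l + 1)).card with hN
  have hmax := maxDim_eq hl
  rw [← hldef, ← hN] at hmax
  have hmax' : (G.maxDim p : ℝ) =
      ((∑ i ∈ G.coordsGE (l + 1), G.deg i : ℕ) : ℝ) + l * (p - N) := by exact_mod_cast hmax
  have hl' : (1 : ℝ) ≤ l := by exact_mod_cast hl
  have hA : HNull D.d q (φ '' {s ∈ K | rk (l + 1) s < N}) := by
    rcases Set.eq_empty_or_nonempty {s ∈ K | rk (l + 1) s < N} with h0 | ⟨s₀, -, hs₀⟩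
    · rw [h0, image_empty]; exact HNull.empty hq
    have hN1 : 1 ≤ N := by omega
    refine D.hNull_image_chart hla hla1 h (isCompact_closedBall t ρ) (convex_closedBall t ρ) hKV
      hKd (fun s hs => hs.1) (m := l + 1) (k := N - 1) (by omega) (a := l)
      (b := l + min 1 (l * la)) (by simp) ?_ ?_ ?_ (fun s hs => Nat.le_sub_one_of_lt hs.2) hq ?_
    · have : 0 ≤ min 1 (l * la) := by positivity
      linarith
    · push_cast; linarith [min_le_left 1 (l * la)]
    · linarith [min_le_right 1 (l * la)]
    · rw [← hN, Nat.cast_sub hN1, Nat.cast_one]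
      linarith
  have hB : HNull D.d q (φ '' {s ∈ K | rk l s < p}) := by
    rcases Set.eq_empty_or_nonempty {s ∈ K | rk l s < p} with h0 | ⟨s₀, hs₀K, hs₀⟩
    · rw [h0, image_empty]; exact HNull.empty hq
    have hp1 : 1 ≤ p := by omega
    have hl2 : 2 ≤ l := by
      by_contra! hcon
      have hl1 : l = 1 := by omega
      have hid : ∀ v, coordRestrict (G.coordsGE l) (G.chartDeriv V φ s₀ v) =
          G.chartDeriv V φ s₀ v := fun v => funext fun i => by
        rw [coordRestrict_apply, if_pos (G.mem_coordsGE.2 (hl1 ▸ G.deg_pos i))]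
      have hrank : rk l s₀ = finrank ℝ (Fin p → ℝ) :=
        LinearMap.finrank_range_of_inj fun v w hvw => injective_chartDeriv h.1 (hKV hs₀K) <| by
          rwa [LinearMap.comp_apply, LinearMap.comp_apply, ContinuousLinearMap.coe_coe, hid, hid]
            at hvw
      rw [hrank] at hs₀
      simp at hs₀
    have hQ : ((∑ i ∈ G.coordsGE l, G.deg i : ℕ) : ℝ) =
        ((∑ i ∈ G.coordsGE (l + 1), G.deg i : ℕ) : ℝ) + l * ((G.coordsGE l).card - N) := by
      exact_mod_cast sum_deg_eq_of_between (G.coordsGE_succ_subset l) subset_rfl rfl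
    have hsplit : (l : ℝ) - l * la / (1 + la) = l / (1 + la) := by field_simp; ring
    refine D.hNull_image_chart hla hla1 h (isCompact_closedBall t ρ) (convex_closedBall t ρ) hKV
      hKd (fun s hs => hs.1) (m := l) (k := p - 1) hl (a := l - min 1 (l * la / (1 + la)))
      (b := l) ?_ ?_ le_rfl ?_ (fun s hs => Nat.le_sub_one_of_lt hs.2) hq ?_
    · linarith [min_le_left 1 (l * la / (1 + la))]
    · have : 0 ≤ min 1 (l * la / (1 + la)) := by positivity
      linarith
    · have : l / (1 + la) ≤ l - min 1 (l * la / (1 + la)) := by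
        linarith [min_le_right 1 (l * la / (1 + la))]
      rwa [div_le_iff₀ (by linarith)] at this
    · have := hq2 hl2
      rw [Nat.cast_sub hp1, Nat.cast_one, hQ]
      linarith
  refine (hA.union hB).mono ?_
  rintro x ⟨hx, hxO⟩
  obtain ⟨s, hs, rfl⟩ := hWO.symm.subset ⟨hx.1, hxO⟩
  have hsK : s ∈ K := Metric.ball_subset_closedBall hs
  rcases rank_lt_of_mem_charSet hx hl _ (tangentAt_le_range_chartDeriv h.1 (hKV hsK)) with h1 | h1
  · exact Or.inl ⟨s, ⟨hsK, h1⟩, rfl⟩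
  · exact Or.inr ⟨s, ⟨hsK, h1⟩, rfl⟩

theorem hNull_charSet (hla : 0 < la) (hla1 : la ≤ 1) (hS : IsC1HolderSubmanifold G.n p la S)
    (hl : 1 ≤ G.ellVal p) (hq : 0 < q)
    (hq1 : (G.maxDim p : ℝ) - min 1 (G.ellVal p * la) < q)
    (hq2 : 2 ≤ G.ellVal p → (G.maxDim p : ℝ) - min 1 (G.ellVal p * la / (1 + la)) < q) :
    HNull D.d q (G.charSet p S) := by
  have hloc : ∀ x, ∃ O, x ∈ G.charSet p S →
      IsOpen O ∧ x ∈ O ∧ HNull D.d q (G.charSet p S ∩ O) := fun x => by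
    by_cases hx : x ∈ G.charSet p S
    · obtain ⟨V, φ, h, t, ht, rfl⟩ := hS x hx.1
      obtain ⟨O, hO⟩ := D.exists_isOpen_hNull_charSet_inter hla hla1 h ht hl hq hq1 hq2
      exact ⟨O, fun _ => hO⟩
    · exact ⟨∅, fun h => absurd h hx⟩
  choose O hO using hloc
  obtain ⟨T, hTS, hTc, hT⟩ := TopologicalSpace.countable_cover_nhdsWithin (f := O)
    fun x hx => mem_nhdsWithin_of_mem_nhds ((hO x hx).1.mem_nhds (hO x hx).2.1)
  rcases T.eq_empty_or_nonempty with rfl | hTne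
  · exact (HNull.empty hq).mono (by simpa using hT)
  · obtain ⟨f, rfl⟩ := hTc.exists_eq_range hTne
    refine (HNull.iUnion (A := fun i => G.charSet p S ∩ O (f i))
      fun i => (hO _ (hTS (mem_range_self i))).2.2).mono fun x hx => ?_
    obtain ⟨_, ⟨i, rfl⟩, hxi⟩ := mem_iUnion₂.1 (hT hx)
    exact mem_iUnion.2 ⟨i, hx, hxi⟩

end HomDistOn

/-- **Size of the characteristic set of `C^{1,λ}` submanifolds (Theorem 5.3).**
Let `G` be a stratified group with homogeneous distance `d`, `λ ∈ (0,1]`, and let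
`Σ ⊆ G` be a `p`-dimensional submanifold of class `C^{1,λ}`.  Then, with `ℓ = ℓ(p)`:
`dim_H Σ_c ≤ D(p) - λ` if `ℓ = 1`; `dim_H Σ_c ≤ D(p) - 1` if `ℓ ≥ 2` and
`λ ≥ 1/(ℓ-1)`; and `dim_H Σ_c ≤ D(p) - ℓλ/(1+λ)` if `ℓ ≥ 2` and `λ ≤ 1/(ℓ-1)`. -/
theorem statement16 (G : StratifiedGroup) (D : HomDistOn G) (p : ℕ) (la : ℝ)
    (hla : la ∈ Set.Ioc (0 : ℝ) 1) (S : Set G.Pt)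
    (hS : IsC1HolderSubmanifold G.n p la S) :
    (G.ellVal p = 1 →
      hDim D.d (G.charSet p S) ≤ ENNReal.ofReal ((G.maxDim p : ℝ) - la)) ∧
    (2 ≤ G.ellVal p → 1 / ((G.ellVal p : ℝ) - 1) ≤ la →
      hDim D.d (G.charSet p S) ≤ ENNReal.ofReal ((G.maxDim p : ℝ) - 1)) ∧
    (2 ≤ G.ellVal p → la ≤ 1 / ((G.ellVal p : ℝ) - 1) →
      hDim D.d (G.charSet p S) ≤
        ENNReal.ofReal ((G.maxDim p : ℝ) - (G.ellVal p : ℝ) * la / (1 + la))) := by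
  obtain ⟨hla0, hla1⟩ := hla
  refine ⟨fun hl => ?_, fun hl hla2 => ?_, fun hl hla2 => ?_⟩ <;>
    refine hDim_le_ofReal fun q hq hcq => D.hNull_charSet hla0 hla1 hS (by omega) hq ?_ ?_
  · rw [hl, Nat.cast_one, one_mul, min_eq_right hla1]
    exact hcq
  · omega
  · have hl' : (2 : ℝ) ≤ G.ellVal p := by exact_mod_cast hl
    rw [div_le_iff₀ (by linarith)] at hla2
    rw [min_eq_left (by linarith)]
    exact hcq
  · intro _
    have hl' : (2 : ℝ) ≤ G.ellVal p := by exact_mod_cast hl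
    rw [div_le_iff₀ (by linarith)] at hla2
    rw [min_eq_left ((one_le_div (by linarith)).2 (by linarith))]
    exact hcq
  all_goals
    have hl' : (2 : ℝ) ≤ G.ellVal p := by exact_mod_cast hl
    rw [le_div_iff₀ (by linarith)] at hla2
    have hle : (G.ellVal p : ℝ) * la / (1 + la) ≤ 1 := (div_le_one (by linarith)).2 (by linarith)
  · have hle' : (G.ellVal p : ℝ) * la / (1 + la) ≤ G.ellVal p * la :=
      div_le_self (by positivity) (by linarith)
    linarith [le_min hle hle']
  · intro _
    rw [min_eq_right hle]
    exact hcq
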